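/- Gorenstein criterion: for a Nakayama algebra with p > s, Λ is a Gorenstein algebra if and only if every cycle in the resolution quiver consists entirely of black vertices; moreover in that case the Gorenstein dimension equals 2d, where d is the maximal distance of a vertex to the black cycles. -/

import Mathlib

universe u

variable (Λ : Type u) [Ring Λ]

section BasicDefs

variable (M : Type u) [AddCommGroup M] [Module Λ M]

/-- A module is uniserial if its submodules are linearly ordered by inclusion. -/
def IsUniserialMod : Prop := ∀ N N' : Submodule Λ M, N ≤ N' ∨ N' ≤ N

/-- A module is indecomposable if it is nonzero and admits no nontrivial direct sum
decomposition. -/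
def IsIndecomposableMod : Prop :=
  Nontrivial M ∧ ∀ N N' : Submodule Λ M, IsCompl N N' → N = ⊥ ∨ N' = ⊥

/-- The radical of a module: the intersection of all maximal submodules. -/
def modRadical : Submodule Λ M := sInf {N : Submodule Λ M | IsCoatom N}

/-- The socle of a module: the sum of all simple submodules. -/
def modSocle : Submodule Λ M := sSup {N : Submodule Λ M | IsAtom N}

/-- `HasLength Λ M n` : the module `M` has a composition series of length `n`. -/
def HasLength (n : ℕ) : Prop :=
  ∃ c : Fin (n + 1) → Submodule Λ M,
    c 0 = ⊥ ∧ c (Fin.last n) = ⊤ ∧ ∀ i : Fin n, c i.castSucc ⋖ c i.succ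

end BasicDefs

/-- A Nakayama algebra: an artinian ring all of whose finite-length indecomposable
(left) modules are uniserial. -/
class IsNakayama : Prop where
  artinian : IsArtinianRing Λ
  serial : ∀ (M : Type u) [AddCommGroup M] [Module Λ M],
    (∃ n, HasLength Λ M n) → IsIndecomposableMod Λ M → IsUniserialMod Λ M

/-- `Λ` has no simple projective module. -/
def NoSimpleProjectives : Prop :=
  ∀ (M : Type u) [AddCommGroup M] [Module Λ M], IsSimpleModule Λ M → ¬ Module.Projective Λ M

/-- `Λ` is connected: no nontrivial central idempotents. -/
def IsConnectedAlg : Prop :=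
  ∀ e : Λ, IsIdempotentElem e → (∀ x : Λ, e * x = x * e) → e = 0 ∨ e = 1

section Covers

variable {Λ}
variable {P M : Type u} [AddCommGroup P] [Module Λ P] [AddCommGroup M] [Module Λ M]

/-- `p : P → M` is a projective cover: `P` projective, `p` surjective with superfluous
kernel. -/
structure IsProjCover (p : P →ₗ[Λ] M) : Prop where
  projective : Module.Projective Λ P
  surjective : Function.Surjective p
  superfluous : LinearMap.ker p ≤ modRadical Λ P

end Covers

/-- `S` is (isomorphic to) the top `M/rad M` of `M`, and is simple. -/
def IsTopOf (S M : Type u) [AddCommGroup S] [Module Λ S] [AddCommGroup M] [Module Λ M] :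
    Prop :=
  IsSimpleModule Λ S ∧
    ∃ p : M →ₗ[Λ] S, Function.Surjective p ∧ LinearMap.ker p = modRadical Λ M

/-- `S` is (isomorphic to) the socle of `M`. -/
def IsSocleOf (S M : Type u) [AddCommGroup S] [Module Λ S] [AddCommGroup M] [Module Λ M] :
    Prop :=
  ∃ i : S →ₗ[Λ] M, Function.Injective i ∧ LinearMap.range i = modSocle Λ M

/-- `IsTauOf Λ T S` : `T` is the Auslander–Reiten translate `τ S` of the simple module `S`;
for a Nakayama algebra without simple projectives this means there is a length-2 module
with top `S` and socle `T`. -/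
def IsTauOf (T S : Type u) [AddCommGroup T] [Module Λ T] [AddCommGroup S] [Module Λ S] :
    Prop :=
  IsSimpleModule Λ S ∧ IsSimpleModule Λ T ∧
    ∃ L : ModuleCat.{u} Λ, HasLength Λ L 2 ∧ IsTopOf Λ S L ∧ IsSocleOf Λ T L

/-- `GammaRel Λ S T` : `T = γ S = τ soc P(S)` in the resolution quiver. -/
def GammaRel (S T : Type u) [AddCommGroup S] [Module Λ S] [AddCommGroup T] [Module Λ T] :
    Prop :=
  IsSimpleModule Λ S ∧
    ∃ (P : ModuleCat.{u} Λ) (p : P →ₗ[Λ] S), IsProjCover p ∧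
      ∃ V : ModuleCat.{u} Λ, IsSimpleModule Λ V ∧ IsSocleOf Λ V P ∧ IsTauOf Λ T V

/-- A simple module is black if its projective dimension is at least 2, i.e. the kernel of
its projective cover is not projective. -/
def IsBlackSimple (S : Type u) [AddCommGroup S] [Module Λ S] : Prop :=
  IsSimpleModule Λ S ∧
    ∀ (P : ModuleCat.{u} Λ) (p : P →ₗ[Λ] S), IsProjCover p →
      ¬ Module.Projective Λ (LinearMap.ker p)

/-- A simple module is red if it has projective dimension exactly 1, i.e. the kernel of its
projective cover is projective. -/
def IsRedSimple (S : Type u) [AddCommGroup S] [Module Λ S] : Prop :=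
  IsSimpleModule Λ S ∧
    ∃ (P : ModuleCat.{u} Λ) (p : P →ₗ[Λ] S), IsProjCover p ∧
      Module.Projective Λ (LinearMap.ker p)

/-- A simple module is cyclically black if it lies on a cycle of the resolution quiver all
of whose vertices are black. -/
def IsCyclicallyBlack (S : Type u) [AddCommGroup S] [Module Λ S] : Prop :=
  ∃ (n : ℕ) (C : ℕ → ModuleCat.{u} Λ), 0 < n ∧
    Nonempty ((C 0 : Type u) ≃ₗ[Λ] S) ∧ Nonempty ((C n : Type u) ≃ₗ[Λ] S) ∧
    (∀ i < n, GammaRel Λ (C i) (C (i + 1))) ∧ ∀ i ≤ n, IsBlackSimple Λ (C i)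

/-- An indecomposable projective module is minimal projective if its radical is not
projective. -/
def IsMinimalProjective (P : Type u) [AddCommGroup P] [Module Λ P] : Prop :=
  Module.Projective Λ P ∧ IsIndecomposableMod Λ P ∧
    ¬ Module.Projective Λ (modRadical Λ P)

/-- `M` is Gorenstein projective: it is an image in a complete projective resolution, i.e.
an exact complex of projectives which stays exact after applying `Hom(-, Λ)`. -/
def IsGorensteinProjective (M : Type u) [AddCommGroup M] [Module Λ M] : Prop :=
  ∃ (P : ℤ → ModuleCat.{u} Λ) (d : ∀ i, P (i + 1) →ₗ[Λ] P i),
    (∀ i, Module.Projective Λ (P i)) ∧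
    (∀ i, Function.Exact (d (i + 1)) (d i)) ∧
    (∀ (i : ℤ) (φ : P (i + 1) →ₗ[Λ] Λ), φ.comp (d (i + 1)) = 0 →
      ∃ ψ : P i →ₗ[Λ] Λ, ψ.comp (d i) = φ) ∧
    Nonempty (M ≃ₗ[Λ] LinearMap.range (d 0))

/-- `M` has a finite projective resolution. -/
def HasFinitePD (M : Type u) [AddCommGroup M] [Module Λ M] : Prop :=
  ∃ (n : ℕ) (P : ℕ → ModuleCat.{u} Λ) (d : ∀ i, P (i + 1) →ₗ[Λ] P i)
      (ε : P 0 →ₗ[Λ] M),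
    (∀ i, Module.Projective Λ (P i)) ∧ Function.Surjective ε ∧
    Function.Exact (d 0) ε ∧ (∀ i, Function.Exact (d (i + 1)) (d i)) ∧
    ∀ i, n < i → Subsingleton (P i)

/-- `M` has injective dimension at most `n` (over the ring `Λ`). -/
def InjDimLE (M : Type u) [AddCommGroup M] [Module Λ M] (n : ℕ) : Prop :=
  ∃ (I : ℕ → ModuleCat.{u} Λ) (η : M →ₗ[Λ] I 0) (d : ∀ i, I i →ₗ[Λ] I (i + 1)),
    (∀ i, Module.Injective Λ (I i)) ∧ Function.Injective η ∧
    Function.Exact η (d 0) ∧ (∀ i, Function.Exact (d i) (d (i + 1))) ∧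
    ∀ i, n < i → Subsingleton (I i)

/-- `Λ` is a Gorenstein algebra: finite injective dimension as a left and right module
over itself. -/
def IsGorensteinAlg : Prop :=
  (∃ n, InjDimLE Λ Λ n) ∧ ∃ n, InjDimLE Λᵐᵒᵖ Λ n

/-- Every cycle of the resolution quiver consists of black vertices. -/
def AllCyclesBlack : Prop :=
  ∀ (n : ℕ) (C : ℕ → ModuleCat.{u} Λ), 0 < n →
    (∀ i < n, GammaRel Λ (C i) (C (i + 1))) →
    Nonempty ((C n : Type u) ≃ₗ[Λ] (C 0 : Type u)) →
    ∀ i ≤ n, IsBlackSimple Λ (C i)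

/-- Every cycle of the resolution quiver contains a red vertex. -/
def EveryCycleHasRed : Prop :=
  ∀ (n : ℕ) (C : ℕ → ModuleCat.{u} Λ), 0 < n →
    (∀ i < n, GammaRel Λ (C i) (C (i + 1))) →
    Nonempty ((C n : Type u) ≃ₗ[Λ] (C 0 : Type u)) →
    ∃ i ≤ n, IsRedSimple Λ (C i)

/-- `Λ` is CM-free: every finite-length Gorenstein projective module is projective. -/
def IsCMFree : Prop :=
  ∀ (M : Type u) [AddCommGroup M] [Module Λ M],
    (∃ n, HasLength Λ M n) → IsGorensteinProjective Λ M → Module.Projective Λ M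

/-- `Λ` has exactly `s` isomorphism classes of simple modules. -/
def SimpleCount (s : ℕ) : Prop :=
  ∃ F : Fin s → ModuleCat.{u} Λ,
    (∀ i, IsSimpleModule Λ (F i)) ∧
    (∀ i j, i ≠ j → IsEmpty ((F i : Type u) ≃ₗ[Λ] (F j : Type u))) ∧
    ∀ (S : Type u) [AddCommGroup S] [Module Λ S], IsSimpleModule Λ S →
      ∃ i, Nonempty (S ≃ₗ[Λ] (F i : Type u))

/-- Every (finite length) indecomposable projective module has length `> s`;
this is the condition `p > s`. -/
def MinProjLengthGT (s : ℕ) : Prop :=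
  ∀ (P : Type u) [AddCommGroup P] [Module Λ P],
    Module.Projective Λ P → IsIndecomposableMod Λ P →
      ∀ n, HasLength Λ P n → s < n

/-- An elementary Gorenstein projective module: nonzero, Gorenstein projective,
non-projective, and no proper nonzero factor module is Gorenstein projective. -/
def IsElementary (E : Type u) [AddCommGroup E] [Module Λ E] : Prop :=
  Nontrivial E ∧ (∃ n, HasLength Λ E n) ∧ IsGorensteinProjective Λ E ∧
    ¬ Module.Projective Λ E ∧
    ∀ N : Submodule Λ E, N ≠ ⊥ → N ≠ ⊤ → ¬ IsGorensteinProjective Λ (E ⧸ N)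

/-- `m` is the multiplicity of the simple module `S` as a composition factor of `M`. -/
def MultiplicityOf (S M : Type u) [AddCommGroup S] [Module Λ S] [AddCommGroup M]
    [Module Λ M] (m : ℕ) : Prop :=
  ∃ (n : ℕ) (c : Fin (n + 1) → Submodule Λ M),
    c 0 = ⊥ ∧ c (Fin.last n) = ⊤ ∧ (∀ i : Fin n, c i.castSucc ⋖ c i.succ) ∧
    m = Nat.card {i : Fin n //
      Nonempty ((↥(c i.succ) ⧸ (c i.castSucc).comap (c i.succ).subtype) ≃ₗ[Λ] S)}

/-- From `S`, the cycles of the resolution quiver can be reached (in a black-cycle vertex)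
in `m` steps. -/
def ReachesBlackIn (S : Type u) [AddCommGroup S] [Module Λ S] (m : ℕ) : Prop :=
  ∃ C : ℕ → ModuleCat.{u} Λ, Nonempty ((C 0 : Type u) ≃ₗ[Λ] S) ∧
    (∀ i < m, GammaRel Λ (C i) (C (i + 1))) ∧ IsCyclicallyBlack Λ (C m)

/-- `d` is the maximal distance of a vertex of the resolution quiver to the black cycles. -/
def MaxDistToBlack (d : ℕ) : Prop :=
  (∀ (S : Type u) [AddCommGroup S] [Module Λ S], IsSimpleModule Λ S →
      ∃ m ≤ d, ReachesBlackIn Λ S m) ∧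
  ∃ S : ModuleCat.{u} Λ, IsSimpleModule Λ S ∧ ∀ m < d, ¬ ReachesBlackIn Λ (S : Type u) m

section Comb

theorem itmono {f : ℤ → ℤ} (hm : Monotone f) (k : ℕ) : Monotone (f^[k]) := hm.iterate k

theorem itshift {f : ℤ → ℤ} {N : ℤ} (hN : ∀ x, f (x + N) = f x + N) (k : ℕ) (x : ℤ) :
    f^[k] (x + N) = f^[k] x + N := by
  induction k generalizing x with
  | zero => rfl
  | succ k ih => rw [Function.iterate_succ_apply, hN, ih, Function.iterate_succ_apply]

theorem shift_mul {f : ℤ → ℤ} {N : ℤ} (hN : ∀ x, f (x + N) = f x + N) (t : ℤ) (x : ℤ) :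
    f (x + t * N) = f x + t * N := by
  induction t using Int.induction_on with
  | zero => simp
  | succ i ih => rw [add_mul, ← add_assoc, one_mul, hN, ih]; ring
  | pred i ih =>
    have := hN (x + (-(i:ℤ) - 1) * N)
    rw [show x + (-(i:ℤ) - 1) * N + N = x + -(i:ℤ) * N by ring, ih] at this
    linarith

theorem itgalois {f h : ℤ → ℤ} (gc : ∀ w y, f w ≤ y ↔ w ≤ h y) (k : ℕ) (w y : ℤ) :
    f^[k] w ≤ y ↔ w ≤ h^[k] y := by
  induction k generalizing w y with
  | zero => rfl
  | succ k ih => rw [Function.iterate_succ_apply, ih, gc, Function.iterate_succ_apply']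

/-- All elements of the image of `f^k` are black. -/
def BlkZ (f : ℤ → ℤ) (k : ℕ) : Prop := ∀ x, f (f^[k] x) < f (f^[k] x + 1)

theorem BlkZ.strict {f : ℤ → ℤ} (hm : Monotone f) {k : ℕ} (hb : BlkZ f k) (j : ℕ) (x : ℤ) (y : ℤ)
    (hxy : f^[k] x < y) : f^[j] (f^[k] x) < f^[j] y := by
  induction j generalizing x y with
  | zero => exact hxy
  | succ j ih =>
    rw [Function.iterate_succ_apply, Function.iterate_succ_apply]
    have h1 : f (f^[k] x) < f y := lt_of_lt_of_le (hb x) (hm hxy)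
    rw [← Function.iterate_succ_apply' f, Function.iterate_succ_apply] at h1 ⊢
    exact ih _ _ h1

theorem BlkZ.surj {f : ℤ → ℤ} (hm : Monotone f) {N : ℤ} (hN0 : 0 < N)
    (hN : ∀ x, f (x + N) = f x + N) {k : ℕ} (hb : BlkZ f k) (x : ℤ) :
    ∃ y, f^[k] x = f^[k+1] y := by
  set z := f^[k] x with hz
  -- pigeonhole on f^[m] z mod N
  have hnot : ¬ Function.Injective (fun m : ℕ => (⟨(f^[m] z) % N, Int.emod_nonneg _ hN0.ne',
      Int.emod_lt_of_pos _ hN0⟩ : Set.Ico (0:ℤ) N)) := by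
    intro hi
    exact not_injective_infinite_finite _ hi
  simp only [Function.Injective, not_forall] at hnot
  obtain ⟨m, n, hmn, hne⟩ := hnot
  have key : ∀ m n : ℕ, m < n → (f^[m] z) % N = (f^[n] z) % N → ∃ y, z = f^[k+1] y := by
    intro m n hlt he
    obtain ⟨t, ht⟩ := Int.ModEq.dvd (he : f^[m] z ≡ f^[n] z [ZMOD N])
    have h2 : f^[n] z = f^[m] (z + t * N) := by
      rw [shift_mul (itshift hN m)]; linarith [mul_comm N t]
    obtain ⟨d, rfl⟩ : ∃ d, n = m + (d + 1) := ⟨n - m - 1, by omega⟩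
    rw [Function.iterate_add_apply] at h2
    have hX1 : f^[d+1] z = f^[k] (f^[d+1] x) := by
      rw [hz, ← Function.iterate_add_apply, ← Function.iterate_add_apply, add_comm]
    have hX2 : z + t * N = f^[k] (x + t * N) := by rw [shift_mul (itshift hN k)]
    have h3 : f^[d+1] z = z + t * N := by
      rcases lt_trichotomy (f^[d+1] z) (z + t * N) with h | h | h
      · rw [hX1] at h
        have := hb.strict hm m _ _ h
        rw [← hX1, h2] at this; exact absurd this (lt_irrefl _)
      · exact h
      · rw [hX2] at h
        have := hb.strict hm m _ _ h
        rw [← hX2, h2] at this; exact absurd this (lt_irrefl _)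
    refine ⟨f^[d] (x - t * N), ?_⟩
    have h4 : x - t * N = x + (-t) * N := by ring
    rw [← Function.iterate_add_apply, h4, shift_mul (itshift hN _)]
    have : f^[k + 1 + d] x = z + t * N := by
      rw [← h3, hz, ← Function.iterate_add_apply]; congr 1; omega
    rw [this]; ring
  have hmn' : (f^[m] z) % N = (f^[n] z) % N := congrArg Subtype.val hmn
  rcases lt_or_gt_of_ne hne with h | h
  · exact key m n h hmn'
  · exact key n m h hmn'.symm

/-- duality: the image of `h^k` -/
theorem BlkZ.dual {f h : ℤ → ℤ} (hm : Monotone f) (gc : ∀ w y, f w ≤ y ↔ w ≤ h y) {N : ℤ}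
    (hN0 : 0 < N) (hN : ∀ x, f (x + N) = f x + N) {k : ℕ} (hb : BlkZ f k) (b : ℤ) :
    h (h^[k] b - 1) < h (h^[k] b) := by
  set z := h^[k] b with hz
  have hsurj : ∀ j x, ∃ y, f^[k] x = f^[k+j] y := by
    intro j
    induction j with
    | zero => exact fun x => ⟨x, rfl⟩
    | succ j ih =>
      intro x
      obtain ⟨y, hy⟩ := ih x
      obtain ⟨y', hy'⟩ := hb.surj hm hN0 hN y
      refine ⟨y', ?_⟩
      rw [hy, add_comm k j, Function.iterate_add_apply, hy', ← Function.iterate_add_apply]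
      congr 1; omega
  obtain ⟨y, hy⟩ := hsurj (k + 1) z
  have hy2 : f^[k] z = f^[k] (f^[k] (f y)) := by
    rw [hy, ← Function.iterate_succ_apply, ← Function.iterate_add_apply]
  have hz1 : f^[k] z ≤ b := (itgalois gc k z b).2 le_rfl
  have hu : f^[k] (f y) ≤ z := (itgalois gc k _ b).1 (hy2 ▸ hz1)
  have hzu : z = f^[k] (f y) := by
    rcases lt_or_eq_of_le hu with h1 | h1
    · have := hb.strict hm k _ _ h1
      rw [← hy2] at this; exact absurd this (lt_irrefl _)
    · exact h1.symm
  rw [← Function.iterate_succ_apply, Function.iterate_succ_apply'] at hzu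
  set w := f^[k] y
  have h1 : w ≤ h z := (gc _ _).1 hzu.ge
  have h2 : h (z - 1) < w := by
    by_contra hc
    have := (gc _ _).2 (not_lt.1 hc)
    omega
  omega

end Comb

/-- Self-dual combinatorial data attached to an artinian serial ring. -/
structure ZSerial (R : Type u) [Ring R] (B : Type) where
  e : B → ℤ → R
  p : B → ℤ → ℤ → R
  f : B → ℤ → ℤ
  h : B → ℤ → ℤ
  N : B → ℤ
  p_self : ∀ b x, p b x x = e b x
  p_comp : ∀ b x y z, x ≤ y → y ≤ z → p b y z * p b x y = p b x z
  p_zero : ∀ b x y, x ≤ y → (p b x y = 0 ↔ f b x ≤ y)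
  left : ∀ b x r, r * e b x = r → r ≠ 0 → ∃ y, x ≤ y ∧ (∃ t, r = t * p b x y) ∧ ∃ t, p b x y = t * r
  right : ∀ b y r, e b y * r = r → r ≠ 0 → ∃ x, x ≤ y ∧ (∃ t, r = p b x y * t) ∧ ∃ t, p b x y = r * t
  full : (1 : R) ∈ AddSubgroup.closure {t : R | ∃ r b x s, t = r * e b x * s}
  nil : ∀ b x y, x < y → ∀ r s, IsNilpotent (r * p b x y * s)
  mono : ∀ b, Monotone (f b)
  gc : ∀ b w y, f b w ≤ y ↔ w ≤ h b y
  Npos : ∀ b, 0 < N b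
  shift : ∀ b x, f b (x + N b) = f b x + N b
  big : ∀ b x, x + N b < f b x

namespace ZSerial
variable {R : Type u} [Ring R] {B : Type} (D : ZSerial R B)

theorem idem (b x) : D.e b x * D.e b x = D.e b x := by
  have := D.p_comp b x x x le_rfl le_rfl
  rwa [D.p_self] at this

theorem e_p (b x y) (h : x ≤ y) : D.e b y * D.p b x y = D.p b x y := by
  rw [← D.p_self, D.p_comp _ _ _ _ h le_rfl]

theorem p_e (b x y) (h : x ≤ y) : D.p b x y * D.e b x = D.p b x y := by
  rw [← D.p_self, D.p_comp _ _ _ _ le_rfl h]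

/-- position sequence -/
def pos (b : B) (a : ℤ) (n : ℕ) : ℤ := (D.f b)^[n / 2] (a + (n % 2 : ℕ))

theorem pos_zero (b a) : D.pos b a 0 = a := by simp [pos]
theorem pos_one (b a) : D.pos b a 1 = a + 1 := by simp [pos]
theorem pos_add_two (b a n) : D.pos b a (n + 2) = D.f b (D.pos b a n) := by
  unfold pos
  rw [show (n + 2) / 2 = n / 2 + 1 by omega, show (n + 2) % 2 = n % 2 by omega,
    Function.iterate_succ_apply']
theorem pos_le (b a n) : D.pos b a n ≤ D.pos b a (n + 1) := by
  induction n using Nat.twoStepInduction with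
  | zero => rw [pos_zero, pos_one]; omega
  | one => rw [pos_add_two, pos_zero, pos_one]; have := D.big b a; have := D.Npos b; omega
  | more n ih _ => rw [pos_add_two, pos_add_two]; exact D.mono b ih
theorem pos_even (b a k) : D.pos b a (2 * k) = (D.f b)^[k] a := by
  unfold pos; simp
theorem pos_odd (b a k) : D.pos b a (2 * k + 1) = (D.f b)^[k] (a + 1) := by
  unfold pos; rw [show (2*k+1)/2 = k by omega, show (2*k+1) % 2 = 1 by omega]; simp

/-- exactness of the projective complex -/
theorem exact (b x y) (hxy : x ≤ y) (hy : y ≤ D.f b x) (r : R) (hr : r * D.p b x y = 0) :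
    ∃ t, r * D.e b y = t * D.p b y (D.f b x) := by
  by_cases h0 : r * D.e b y = 0
  · exact ⟨0, by simp [h0]⟩
  obtain ⟨z, hz, ⟨t, ht⟩, ⟨t', ht'⟩⟩ := D.left b y (r * D.e b y) (by rw [mul_assoc, D.idem]) h0
  have h1 : D.p b x z = 0 := by
    rw [← D.p_comp b x y z hxy hz, ht', mul_assoc, mul_assoc, D.e_p _ _ _ hxy, hr, mul_zero]
  have h2 := (D.p_zero b x z (hxy.trans hz)).1 h1
  exact ⟨t * D.p b (D.f b x) z, by rw [ht, mul_assoc, D.p_comp _ _ _ _ hy h2]⟩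

/-- The vanishing of `Ext^{n+1}(S,M)`, written with elements. -/
def E (b : B) (a : ℤ) (n : ℕ) (M : Type u) [AddCommGroup M] [Module R M] : Prop :=
  ∀ m : M, D.e b (D.pos b a (n+1)) • m = m →
    D.p b (D.pos b a (n+1)) (D.pos b a (n+2)) • m = 0 →
    ∃ m' : M, m = D.p b (D.pos b a n) (D.pos b a (n+1)) • m'

theorem _root_.Module.Injective.divides {M : Type u} [AddCommGroup M] [Module R M]
    (hM : Module.Injective R M) (a : R) (m : M) (h : ∀ r, r * a = 0 → r • m = 0) :
    ∃ m' : M, m = a • m' := by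
  have hB := Module.Baer.of_injective hM
  let g := LinearPMap.mkSpanSingleton' (R := R) (σ := RingHom.id R) a m (by simpa using h)
  obtain ⟨ψ, hψ⟩ := hB g.domain g.toFun
  refine ⟨ψ 1, ?_⟩
  have ha : a ∈ g.domain := Submodule.mem_span_singleton_self a
  have h2 := hψ a ha
  have h3 : g.toFun ⟨a, ha⟩ = m := LinearPMap.mkSpanSingleton'_apply_self a m _ ha
  rw [← map_smul, smul_eq_mul, mul_one, h2, h3]

theorem E_zero_of_injective {M : Type u} [AddCommGroup M] [Module R M]
    (hM : Module.Injective R M) (b a n) : D.E b a n M := by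
  intro m hm h0
  apply hM.divides
  intro r hr
  obtain ⟨t, ht⟩ := D.exact b _ _ (D.pos_le b a n) (by rw [← D.pos_add_two]; exact D.pos_le _ _ _) r hr
  rw [← hm, ← mul_smul, ht, ← D.pos_add_two, mul_smul, h0, smul_zero]

theorem p_pos_comp (b a n) : D.p b (D.pos b a (n+1)) (D.pos b a (n+2)) *
    D.p b (D.pos b a n) (D.pos b a (n+1)) = 0 := by
  rw [D.p_comp _ _ _ _ (D.pos_le _ _ _) (D.pos_le _ _ _), D.p_zero _ _ _ ((D.pos_le _ _ _).trans (D.pos_le _ _ _)),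
    D.pos_add_two]

/-- dimension shifting, downwards -/
theorem E_succ_of {M I M' : Type u} [AddCommGroup M] [Module R M] [AddCommGroup I] [Module R I]
    [AddCommGroup M'] [Module R M'] (hI : Module.Injective R I) (η : M →ₗ[R] I) (π : I →ₗ[R] M')
    (hη : Function.Injective η) (hex : Function.Exact η π) (hπ : Function.Surjective π)
    (b a n) (h : D.E b a n M') : D.E b a (n+1) M := by
  intro m hm h0
  obtain ⟨ψ, hψ⟩ := D.E_zero_of_injective hI b a (n+1) (η m) (by rw [← map_smul, hm])
    (by rw [← map_smul, h0, map_zero])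
  have hle := D.pos_le b a (n+1)
  obtain ⟨θ, hθ⟩ := h (π (D.e b (D.pos b a (n+1)) • ψ)) (by rw [← map_smul, ← mul_smul, D.idem])
    (by rw [← map_smul, ← mul_smul, D.p_e _ _ _ hle, ← hψ]; exact hex.apply_apply_eq_zero m)
  obtain ⟨θ, rfl⟩ := hπ θ
  obtain ⟨m', hm'⟩ := (hex (D.e b (D.pos b a (n+1)) • ψ - D.p b (D.pos b a n) (D.pos b a (n+1)) • θ)).1
    (by rw [map_sub, hθ, map_smul, sub_self])
  refine ⟨m', hη ?_⟩
  rw [map_smul, hm', smul_sub, ← mul_smul, ← mul_smul, D.p_pos_comp, D.p_e _ _ _ hle, ← hψ]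
  simp

/-- dimension shifting, upwards -/
theorem E_of_succ {M I M' : Type u} [AddCommGroup M] [Module R M] [AddCommGroup I] [Module R I]
    [AddCommGroup M'] [Module R M'] (hI : Module.Injective R I) (η : M →ₗ[R] I) (π : I →ₗ[R] M')
    (hη : Function.Injective η) (hex : Function.Exact η π) (hπ : Function.Surjective π)
    (b a n) (h : D.E b a (n+1) M) : D.E b a n M' := by
  intro ψ hψ h0
  obtain ⟨ψ', hψ'⟩ := hπ ψ
  have hle := D.pos_le b a (n+1)
  obtain ⟨φ, hφ⟩ := (hex (D.p b (D.pos b a (n+1)) (D.pos b a (n+2)) • ψ')).1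
    (by rw [map_smul, hψ', h0])
  obtain ⟨χ, hχ⟩ := h φ
    (hη (by rw [map_smul, hφ, ← mul_smul, D.e_p _ _ _ hle]))
    (hη (by rw [map_smul, hφ, ← mul_smul, D.p_pos_comp, zero_smul, map_zero]))
  obtain ⟨θ, hθ⟩ := D.E_zero_of_injective hI b a n (D.e b (D.pos b a (n+1)) • (ψ' - η χ))
    (by rw [← mul_smul, D.idem])
    (by rw [← mul_smul, D.p_e _ _ _ hle, smul_sub, ← hφ, hχ, map_smul, sub_self])
  refine ⟨π θ, ?_⟩
  rw [← map_smul, ← hθ, map_smul, map_sub, hψ', hex.apply_apply_eq_zero, sub_zero, hψ]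

theorem exists_ne {M : Type u} [AddCommGroup M] [Module R M] (P : Submodule R M) (hP : P ≠ ⊤) :
    ∃ b x, ∃ m : M, m ∉ P ∧ D.e b x • m = m ∧ D.p b x (x+1) • m ∈ P := by
  obtain ⟨m, hm⟩ : ∃ m, m ∉ P := by
    by_contra hc; push Not at hc; exact hP (eq_top_iff.2 fun x _ => hc x)
  have h1 : ∃ (b : B) (x : ℤ) (s : R), D.e b x • s • m ∉ P := by
    by_contra hc
    push Not at hc
    have : ∀ t ∈ AddSubgroup.closure {t : R | ∃ r b x s, t = r * D.e b x * s}, t • m ∈ P := by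
      intro t ht
      induction ht using AddSubgroup.closure_induction with
      | mem t ht =>
        obtain ⟨r, b, x, s, rfl⟩ := ht
        rw [mul_smul, mul_smul]; exact P.smul_mem _ (hc b x s)
      | zero => simp
      | add _ _ _ _ h1 h2 => rw [add_smul]; exact P.add_mem h1 h2
      | neg _ _ h1 => rw [neg_smul]; exact P.neg_mem h1
    exact hm (by simpa using this 1 D.full)
  obtain ⟨b, x, s, hs⟩ := h1
  -- last nonzero
  set m0 := s • m
  have hex : ∃ l : ℕ, D.p b x (x + l) • m0 ∈ P := by
    refine ⟨(D.f b x - x).toNat, ?_⟩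
    have h1 := D.big b x
    have h2 := D.Npos b
    rw [(D.p_zero b x _ (by omega)).2 (by omega), zero_smul]; exact P.zero_mem
  classical
  have hf := Nat.find_spec hex
  set l := Nat.find hex with hl
  have hl0 : l ≠ 0 := by
    intro h; rw [h] at hf; simp only [Nat.cast_zero, add_zero, D.p_self] at hf; exact hs hf
  obtain ⟨k, hk⟩ := Nat.exists_eq_succ_of_ne_zero hl0
  have hmin := Nat.find_min hex (m := k) (by omega)
  refine ⟨b, x + k, D.p b x (x+k) • m0, hmin, ?_, ?_⟩
  · rw [← mul_smul, D.e_p _ _ _ (by omega)]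
  · rw [← mul_smul, D.p_comp _ _ _ _ (by omega) (by omega)]
    rw [hk] at hf
    convert hf using 3
    push_cast; ring

theorem injective_of_E {M : Type u} [AddCommGroup M] [Module R M]
    (h : ∀ b a, D.E b a 0 M) : Module.Injective R M := by
  constructor
  intro X Y _ _ _ _ i hi g
  haveI : Fact (Function.Injective i) := ⟨hi⟩
  -- maximal extension
  let φ := Module.Baer.extensionOfMax i g
  have htop : φ.domain = ⊤ := by
    by_contra hne
    obtain ⟨b, x, n, hn, hen, hpn⟩ := D.exists_ne φ.domain hne
    have hbig := D.big b x
    have hNp := D.Npos b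
    obtain ⟨m', hm'⟩ := h b x (φ.toLinearPMap ⟨_, hpn⟩)
      (by rw [← LinearPMap.map_smul]; congr 1; ext1
          simp only [SetLike.val_smul]
          rw [← mul_smul, D.pos_one, D.e_p _ _ _ (by omega)])
      (by rw [← LinearPMap.map_smul]
          rw [← LinearPMap.map_zero φ.toLinearPMap]; congr 1; ext1
          simp only [SetLike.val_smul, Submodule.coe_zero]
          rw [← mul_smul, D.pos_one, D.pos_add_two, D.pos_zero, D.p_comp _ _ _ _ (by omega) (by omega),
            (D.p_zero _ _ _ (by omega)).2 le_rfl, zero_smul])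
    rw [D.pos_zero, D.pos_one] at hm'
    have hc : ∀ c : R, (hc : c • n ∈ φ.domain) → φ.toLinearPMap ⟨c • n, hc⟩ = c • D.e b x • m' := by
      intro c hc
      have : ∃ t, c * D.e b x = t * D.p b x (x+1) := by
        by_cases h0 : c * D.e b x = 0
        · exact ⟨0, by simp [h0]⟩
        obtain ⟨z, hz, ⟨t, ht⟩, ⟨t', ht'⟩⟩ := D.left b x (c * D.e b x) (by rw [mul_assoc, D.idem]) h0
        rcases eq_or_lt_of_le hz with rfl | hz
        · exfalso; apply hn
          rw [← hen, ← D.p_self, ht', mul_smul, mul_smul, hen]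
          exact Submodule.smul_mem _ _ hc
        · exact ⟨t * D.p b (x+1) z, by rw [ht, mul_assoc, D.p_comp _ _ _ _ (by omega) (by omega)]⟩
      obtain ⟨t, ht⟩ := this
      rw [← mul_smul, ht, mul_smul, ← hm', ← LinearPMap.map_smul]
      congr 1; ext1
      simp only [SetLike.val_smul]
      rw [← mul_smul, ← ht, mul_smul, hen]
    let g' : Y →ₗ.[R] M := LinearPMap.mkSpanSingleton' (σ := RingHom.id R) n (D.e b x • m') (by
      intro c hcn
      have := hc c (by rw [hcn]; exact Submodule.zero_mem _)
      rw [RingHom.id_apply, ← this, ← LinearPMap.map_zero φ.toLinearPMap]; congr 1; ext1; exact hcn)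
    have hag : ∀ (x : φ.toLinearPMap.domain) (y : g'.domain), (x : Y) = y → φ.toLinearPMap x = g' y := by
      rintro ⟨y1, hy1⟩ ⟨y2, hy2⟩ hyy
      simp only at hyy
      subst hyy
      obtain ⟨c, rfl⟩ := Submodule.mem_span_singleton.1 hy2
      rw [hc c hy1, LinearPMap.mkSpanSingleton'_apply]; rfl
    let ψ := φ.toLinearPMap.sup g' hag
    have hle : φ.toLinearPMap ≤ ψ := LinearPMap.left_le_sup _ _ hag
    let Ψ : Module.Baer.ExtensionOf i g :=
      { ψ with
        le := φ.le.trans hle.1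
        is_extension := fun m => by
          rw [φ.is_extension m]
          exact hle.2 rfl }
    have heq := Module.Baer.extensionOfMax_is_max i g Ψ hle
    have hnd : n ∈ Ψ.domain := by
      have : g'.domain ≤ ψ.domain := (LinearPMap.right_le_sup _ _ hag).1
      exact this (Submodule.mem_span_singleton_self n)
    rw [heq] at hnd
    exact hn hnd
  refine ⟨φ.toLinearPMap.toFun.comp (LinearMap.codRestrict _ LinearMap.id (fun x => by rw [htop]; trivial)), ?_⟩
  intro x
  have := φ.is_extension x
  rw [this]; rfl

end ZSerial

section InjDim
variable {R : Type u} [Ring R]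

theorem InjDimLE.mono {M : Type u} [AddCommGroup M] [Module R M] {m n : ℕ} (hmn : m ≤ n)
    (h : InjDimLE R M m) : InjDimLE R M n := by
  obtain ⟨I, η, d, h1, h2, h3, h4, h5⟩ := h
  exact ⟨I, η, d, h1, h2, h3, h4, fun i hi => h5 i (by omega)⟩

theorem InjDimLE.congr {M M' : Type u} [AddCommGroup M] [Module R M] [AddCommGroup M'] [Module R M']
    (φ : M' ≃ₗ[R] M) {n : ℕ}
    (h : InjDimLE R M n) : InjDimLE R M' n := by
  obtain ⟨I, η, d, h1, h2, h3, h4, h5⟩ := h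
  refine ⟨I, η.comp φ.toLinearMap, d, h1, h2.comp φ.injective, ?_, h4, h5⟩
  intro y
  rw [h3 y]
  constructor
  · rintro ⟨x, rfl⟩; exact ⟨φ.symm x, by simp⟩
  · rintro ⟨x, rfl⟩; exact ⟨φ x, by simp⟩

theorem InjDimLE.zero_injective {M : Type u} [AddCommGroup M] [Module R M]
    (h : InjDimLE R M 0) : Module.Injective R M := by
  obtain ⟨I, η, d, h1, h2, h3, h4, h5⟩ := h
  have hs : Function.Surjective η := by
    intro y
    have := h5 1 (by omega)
    exact (h3 y).1 (Subsingleton.elim _ _)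
  let e := LinearEquiv.ofBijective η ⟨h2, hs⟩
  constructor
  intro X Y _ _ _ _ i hi g
  obtain ⟨k, hk⟩ := (h1 0).out i hi (η.comp g)
  refine ⟨e.symm.toLinearMap.comp k, fun x => ?_⟩
  simp only [LinearMap.comp_apply, hk]
  exact e.symm_apply_apply (g x)

theorem InjDimLE.of_injective {M : Type u} [AddCommGroup M] [Module R M]
    (h : Module.Injective R M) : InjDimLE R M 0 := by
  refine ⟨fun i => match i with | 0 => ModuleCat.of R M | _ + 1 => ModuleCat.of R PUnit,
    LinearMap.id, fun _ => 0, ?_, fun _ _ h => h, ?_, ?_, ?_⟩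
  · rintro (_ | i)
    · exact h
    · exact ⟨fun _ _ _ _ _ _ i _ g => ⟨0, fun x => Subsingleton.elim (α := PUnit) _ _⟩⟩
  · intro y; simp
  · intro i y
    simp only [LinearMap.zero_apply, true_iff]
    exact ⟨0, Subsingleton.elim (α := PUnit) _ _⟩
  · rintro (_ | i) hi
    · omega
    · exact inferInstanceAs (Subsingleton PUnit)

theorem InjDimLE.succ {M : Type u} [AddCommGroup M] [Module R M] {n : ℕ}
    (h : InjDimLE R M (n+1)) : ∃ (I M' : ModuleCat.{u} R) (η : M →ₗ[R] I) (π : I →ₗ[R] M'),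
    Module.Injective R I ∧ Function.Injective η ∧ Function.Exact η π ∧ Function.Surjective π ∧
    InjDimLE R M' n := by
  obtain ⟨I, η, d, h1, h2, h3, h4, h5⟩ := h
  refine ⟨I 0, ModuleCat.of R (LinearMap.range (d 0)), η, (d 0).rangeRestrict, h1 0, h2, ?_,
    LinearMap.surjective_rangeRestrict _, ?_⟩
  · intro y
    rw [← h3 y, ← Subtype.coe_inj]; rfl
  · refine ⟨fun i => I (i+1), (LinearMap.range (d 0)).subtype, fun i => d (i+1), fun i => h1 _,
      Subtype.val_injective, ?_, fun i => h4 _, fun i hi => h5 _ (by omega)⟩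
    intro y
    rw [h4 0 y]; simp

theorem InjDimLE.of_succ {n : ℕ} {M : Type u} [AddCommGroup M] [Module R M] (I M' : ModuleCat.{u} R)
    (η : M →ₗ[R] I) (π : I →ₗ[R] M')
    (hI : Module.Injective R I) (hη : Function.Injective η) (hex : Function.Exact η π)
    (hπ : Function.Surjective π) (h : InjDimLE R M' n) : InjDimLE R M (n+1) := by
  obtain ⟨J, θ, d, h1, h2, h3, h4, h5⟩ := h
  let I' : ℕ → ModuleCat.{u} R := fun i => match i with | 0 => I | i + 1 => J i
  let d' : ∀ i, I' i →ₗ[R] I' (i+1) := fun i => match i with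
    | 0 => θ.comp π
    | i + 1 => d i
  refine ⟨I', η, d', ?_, hη, ?_, ?_, ?_⟩
  · rintro (_ | i)
    · exact hI
    · exact h1 i
  · intro y
    rw [← hex y]
    change θ (π y) = 0 ↔ _
    rw [map_eq_zero_iff _ h2]
  · rintro (_ | i)
    · intro y
      change d 0 y = 0 ↔ y ∈ Set.range (θ.comp π)
      rw [h3 y]
      constructor
      · rintro ⟨x, rfl⟩
        obtain ⟨z, rfl⟩ := hπ x
        exact ⟨z, rfl⟩
      · rintro ⟨x, rfl⟩; exact ⟨_, rfl⟩
    · exact h4 i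
  · rintro (_ | i) hi
    · omega
    · exact h5 i (by omega)

theorem exists_injective_embedding (M : Type u) [AddCommGroup M] [Module R M] :
    ∃ (I : ModuleCat.{u} R) (η : M →ₗ[R] I), Module.Injective R I ∧ Function.Injective η := by
  obtain ⟨⟨J, hJ, f, hf⟩⟩ := CategoryTheory.EnoughInjectives.presentation (ModuleCat.of R M)
  refine ⟨J, f.hom, ?_, ?_⟩
  · exact (Module.injective_iff_injective_object R J).2 hJ
  · exact (ModuleCat.mono_iff_injective f).1 hf

namespace ZSerial
variable {B : Type} (D : ZSerial R B)

theorem E_of_injDimLE (n : ℕ) : ∀ (M : Type u) [AddCommGroup M] [Module R M],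
    InjDimLE R M n → ∀ b a, D.E b a n M := by
  induction n with
  | zero => intro M _ _ h b a; exact D.E_zero_of_injective h.zero_injective b a 0
  | succ n ih =>
    intro M _ _ h b a
    obtain ⟨I, M', η, π, h1, h2, h3, h4, h5⟩ := h.succ
    exact D.E_succ_of h1 η π h2 h3 h4 b a n (ih M' h5 b a)

theorem injDimLE_of_E (n : ℕ) : ∀ (M : Type u) [AddCommGroup M] [Module R M],
    (∀ b a, D.E b a n M) → InjDimLE R M n := by
  induction n with
  | zero => intro M _ _ h; exact InjDimLE.of_injective (D.injective_of_E h)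
  | succ n ih =>
    intro M _ _ h
    obtain ⟨I, η, hI, hη⟩ := exists_injective_embedding (R := R) M
    have hex : Function.Exact η (LinearMap.range η).mkQ := by
      intro y; simp
    exact InjDimLE.of_succ I (ModuleCat.of R (I ⧸ LinearMap.range η)) η (LinearMap.range η).mkQ hI hη
      hex (Submodule.mkQ_surjective _)
      (ih _ fun b a => D.E_of_succ hI η (LinearMap.range η).mkQ hη hex (Submodule.mkQ_surjective _) b a n (h b a))

/-- if `p(x,y)` factors through nilpotents it vanishes -/
theorem fact_zero (b x y) (hxy : x + 1 ≤ y) (v : R) (h : D.p b (x+1) y = D.p b x y * v) :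
    D.p b (x+1) y = 0 := by
  have h1 : D.p b (x+1) y = D.p b (x+1) y * (D.p b x (x+1) * v) := by
    rw [← mul_assoc, D.p_comp _ _ _ _ (by omega) hxy, ← h]
  have hn := D.nil b x (x+1) (by omega) 1 v
  rw [one_mul] at hn
  obtain ⟨k, hk⟩ := hn
  have : ∀ k : ℕ, D.p b (x+1) y = D.p b (x+1) y * (D.p b x (x+1) * v) ^ k := by
    intro k
    induction k with
    | zero => simp
    | succ k ih => rw [pow_succ', ← mul_assoc, ← h1]; exact ih
  rw [this k, hk, mul_zero]

theorem E_even_of_blk (k : ℕ) (b a) (hb : BlkZ (D.f b) k) : D.E b a (2*k) R := by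
  intro m hm h0
  rw [D.pos_odd, D.pos_add_two, D.pos_even] at *
  by_cases hm0 : m = 0
  · exact ⟨0, by simp [hm0]⟩
  simp only [smul_eq_mul] at *
  obtain ⟨w, hw, ⟨t, ht⟩, ⟨t', ht'⟩⟩ := D.right b _ m hm hm0
  set x := (D.f b)^[k] a
  set y := (D.f b)^[k] (a+1)
  have hyz : y ≤ D.f b x := by
    have := D.pos_le b a (2*k+1)
    rwa [D.pos_odd, D.pos_add_two, D.pos_even] at this
  have hxy : x ≤ y := itmono (D.mono b) k (by omega)
  have h1 : D.p b w (D.f b x) = 0 := by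
    rw [← D.p_comp b w y _ hw hyz, ht', ← mul_assoc, h0, zero_mul]
  rw [D.p_zero _ _ _ (hw.trans hyz)] at h1
  have h2 : w ≤ x := by
    by_contra hlt
    have := lt_of_lt_of_le (hb a) (D.mono b (show x + 1 ≤ w by omega))
    change D.f b x < _ at this
    omega
  exact ⟨D.p b w x * t, by rw [← mul_assoc, D.p_comp _ _ _ _ h2 hxy, ht]⟩

theorem h_spec (b k x) : (D.f b)^[k] ((D.h b)^[k] x) ≤ x := (itgalois (D.gc b) k _ _).2 le_rfl
theorem h_spec' (b k x) : x < (D.f b)^[k] ((D.h b)^[k] x + 1) := by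
  by_contra hc
  have := (itgalois (D.gc b) k _ _).1 (not_lt.1 hc)
  omega
theorem it_le (b k a) : (D.f b)^[k] (a + 1) ≤ (D.f b)^[k] a + D.N b := by
  rw [← itshift (D.shift b)]
  exact itmono (D.mono b) k (by have := D.Npos b; omega)

theorem blk_of_E_even (k : ℕ) (b) (h : ∀ a, D.E b a (2*k) R) : BlkZ (D.f b) k := by
  intro j
  by_contra hred
  rw [not_lt] at hred
  set x := (D.f b)^[k] j with hx
  set a := (D.h b)^[k] x with ha
  have ha1 : (D.f b)^[k] a = x := by
    apply le_antisymm (D.h_spec b k x)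
    conv_lhs => rw [hx]
    apply itmono (D.mono b)
    exact (itgalois (D.gc b) k _ _).1 hx.ge
  have ha2 := D.h_spec' b k x
  rw [← ha] at ha2
  have hy := D.it_le b k a
  rw [ha1] at hy
  have hbig := D.big b x
  have hbig1 := D.big b (x+1)
  have hh := h a
  unfold E at hh
  rw [D.pos_odd, D.pos_add_two, D.pos_even, ha1] at hh
  set y := (D.f b)^[k] (a+1)
  obtain ⟨v, hv⟩ := hh (D.p b (x+1) y) (D.e_p _ _ _ (by omega)) (by
    rw [smul_eq_mul, D.p_comp _ _ _ _ (by omega) (by omega), D.p_zero _ _ _ (by omega)]; exact hred)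
  have := D.fact_zero b x y (by omega) v hv
  rw [D.p_zero _ _ _ (by omega)] at this
  omega

theorem blk_of_E_odd (k : ℕ) (b) (h : ∀ a, D.E b a (2*k+1) R) : BlkZ (D.f b) k := by
  intro j
  by_contra hred
  rw [not_lt] at hred
  set x := (D.f b)^[k] j with hx
  set a := (D.h b)^[k+1] (D.f b x - 1) with ha
  have hz := D.h_spec b (k+1) (D.f b x - 1)
  have hz' := D.h_spec' b (k+1) (D.f b x - 1)
  rw [← ha] at hz hz'
  rw [Function.iterate_succ_apply'] at hz hz'
  set y := (D.f b)^[k] (a+1) with hy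
  -- a + 1 ≤ j
  have haj : a + 1 ≤ j := by
    by_contra hc
    have := D.mono b (itmono (D.mono b) k (show j ≤ a by omega))
    rw [← hx] at this
    omega
  have hyx : y ≤ x := itmono (D.mono b) k haj
  have hfy : D.f b y = D.f b x := le_antisymm (D.mono b hyx) (by omega)
  have hred' : D.f b (y+1) ≤ D.f b y := by
    rw [hfy]; exact (D.mono b (by omega)).trans hred
  have h1 := D.it_le b k a
  have hbig := D.big b ((D.f b)^[k] a)
  have hh := h a
  unfold E at hh
  rw [D.pos_add_two, D.pos_add_two, D.pos_odd, D.pos_even, ← hy] at hh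
  set z := D.f b ((D.f b)^[k] a)
  obtain ⟨v, hv⟩ := hh (D.p b (y+1) z) (D.e_p _ _ _ (by omega)) (by
    rw [smul_eq_mul, D.p_comp _ _ _ _ (by omega) (by omega), D.p_zero _ _ _ (by omega)]; exact hred')
  have := D.fact_zero b y z (by omega) v hv
  rw [D.p_zero _ _ _ (by omega)] at this
  have := D.mono b (show y ≤ y+1 by omega)
  omega

theorem injDimLE_iff (n : ℕ) : InjDimLE R R n ↔ ∀ b, BlkZ (D.f b) (n/2) := by
  constructor
  · intro h b
    have hE := D.E_of_injDimLE n R h b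
    rcases Nat.even_or_odd' n with ⟨k, rfl | rfl⟩
    · rw [show 2*k/2 = k by omega]; exact D.blk_of_E_even k b hE
    · rw [show (2*k+1)/2 = k by omega]; exact D.blk_of_E_odd k b hE
  · intro h
    have : InjDimLE R R (2*(n/2)) := D.injDimLE_of_E _ R fun b a => D.E_even_of_blk _ b a (h b)
    exact this.mono (by omega)

open MulOpposite

theorem mem_closure_op (S : Set R) (x : R) (h : x ∈ AddSubgroup.closure S) :
    op x ∈ AddSubgroup.closure (op '' S) := by
  induction h using AddSubgroup.closure_induction with
  | mem t ht => exact AddSubgroup.subset_closure ⟨t, ht, rfl⟩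
  | zero => exact AddSubgroup.zero_mem _
  | add _ _ _ _ h1 h2 => rw [op_add]; exact AddSubgroup.add_mem _ h1 h2
  | neg _ _ h1 => rw [op_neg]; exact AddSubgroup.neg_mem _ h1

/-- the data of the opposite ring -/
def op : ZSerial Rᵐᵒᵖ B where
  e b x := MulOpposite.op (D.e b (-x))
  p b x y := MulOpposite.op (D.p b (-y) (-x))
  f b x := - D.h b (-x)
  h b x := - D.f b (-x)
  N := D.N
  p_self b x := by rw [D.p_self]
  p_comp b x y z hxy hyz := by rw [← op_mul, D.p_comp _ _ _ _ (by omega) (by omega)]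
  p_zero b x y hxy := by
    rw [op_eq_zero_iff, D.p_zero _ _ _ (by omega), D.gc]; omega
  left b x r hr hr0 := by
    obtain ⟨y, hy, ⟨t, ht⟩, ⟨t', ht'⟩⟩ := D.right b (-x) r.unop (by rw [← hr]; simp [← mul_assoc, D.idem]) (by simpa using hr0)
    refine ⟨-y, by omega, ⟨MulOpposite.op t, ?_⟩, ⟨MulOpposite.op t', ?_⟩⟩
    · rw [neg_neg, ← op_mul, ← ht, op_unop]
    · rw [neg_neg, ht', op_mul, op_unop]
  right b x r hr hr0 := by
    obtain ⟨y, hy, ⟨t, ht⟩, ⟨t', ht'⟩⟩ := D.left b (-x) r.unop (by rw [← hr]; simp [mul_assoc, D.idem]) (by simpa using hr0)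
    refine ⟨-y, by omega, ⟨MulOpposite.op t, ?_⟩, ⟨MulOpposite.op t', ?_⟩⟩
    · rw [neg_neg, ← op_mul, ← ht, op_unop]
    · rw [neg_neg, ht', op_mul, op_unop]
  full := by
    refine AddSubgroup.closure_mono ?_ (mem_closure_op _ _ D.full)
    rintro _ ⟨_, ⟨r, b, x, s, rfl⟩, rfl⟩
    exact ⟨MulOpposite.op s, b, -x, MulOpposite.op r, by simp [mul_assoc]⟩
  nil b x y hxy r s := by
    obtain ⟨n, hn⟩ := D.nil b (-y) (-x) (by omega) s.unop r.unop
    refine ⟨n, ?_⟩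
    apply unop_injective
    rw [unop_pow]
    simpa [mul_assoc] using hn
  mono b x y hxy := by
    have : D.h b (-y) ≤ D.h b (-x) := (D.gc b _ _).1 (((D.gc b _ _).2 le_rfl).trans (by omega))
    simpa using this
  gc b w y := by
    have := D.gc b (-y) (-w)
    omega
  Npos := D.Npos
  shift b x := by
    have h1 : ∀ z, D.h b (z - D.N b) ≤ D.h b z - D.N b := by
      intro z
      have : D.h b (z - D.N b) + D.N b ≤ D.h b z := by
        rw [← D.gc, D.shift]; have := (D.gc b _ (z - D.N b)).2 le_rfl; omega
      omega
    have h2 : ∀ z, D.h b z - D.N b ≤ D.h b (z - D.N b) := by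
      intro z
      rw [← D.gc]
      have h3 := D.shift b (D.h b z - D.N b)
      have := (D.gc b _ z).2 le_rfl
      rw [sub_add_cancel] at h3
      omega
    have := h1 (-x); have := h2 (-x)
    rw [neg_add, ← sub_eq_add_neg]; omega
  big b x := by
    by_contra hc
    have : - x - D.N b ≤ D.h b (-x) := by omega
    rw [← D.gc] at this
    have := D.big b (-x - D.N b)
    omega

theorem op_f_it (b k) (x) : (D.op.f b)^[k] x = - (D.h b)^[k] (-x) := by
  induction k generalizing x with
  | zero => simp
  | succ k ih => rw [Function.iterate_succ_apply', ih, Function.iterate_succ_apply']; simp [op]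

theorem op_h_it (b k) (x) : (D.op.h b)^[k] x = - (D.f b)^[k] (-x) := by
  induction k generalizing x with
  | zero => simp
  | succ k ih => rw [Function.iterate_succ_apply', ih, Function.iterate_succ_apply']; simp [op]

theorem op_blk_iff (b k) : BlkZ (D.op.f b) k ↔ BlkZ (D.f b) k := by
  constructor
  · intro hb x
    have := BlkZ.dual (D.op.mono b) (D.op.gc b) (D.op.Npos b) (D.op.shift b) hb (-x)
    rw [op_h_it, neg_neg] at this
    simp only [op, neg_neg, neg_sub] at this
    rw [show 1 - -(D.f b)^[k] x = (D.f b)^[k] x + 1 by ring] at this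
    omega
  · intro hb x
    have := BlkZ.dual (D.mono b) (D.gc b) (D.Npos b) (D.shift b) hb (-x)
    rw [op_f_it]
    simp only [op, neg_neg]
    rw [show -(-(D.h b)^[k] (-x) + 1) = (D.h b)^[k] (-x) - 1 by ring]
    omega

theorem op_injDimLE_iff (n : ℕ) : InjDimLE Rᵐᵒᵖ R n ↔ ∀ b, BlkZ (D.f b) (n/2) := by
  have h1 : InjDimLE Rᵐᵒᵖ R n ↔ InjDimLE Rᵐᵒᵖ Rᵐᵒᵖ n := by
    let φ : R ≃ₗ[Rᵐᵒᵖ] Rᵐᵒᵖ :=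
      { opAddEquiv with map_smul' := fun r x => by change MulOpposite.op (x * r.unop) = _; rw [op_mul]; rfl }
    exact ⟨fun h => h.congr φ.symm, fun h => h.congr φ⟩
  rw [h1, D.op.injDimLE_iff]
  simp only [op_blk_iff]

end ZSerial
end InjDim

section Ringy
variable {R : Type u} [Ring R]

theorem hasLength_of_finite [IsArtinianRing R] (M : Type u) [AddCommGroup M] [Module R M]
    [Module.Finite R M] : ∃ n, HasLength R M n := by
  obtain ⟨s, h0, h1⟩ := exists_compositionSeries_of_isNoetherian_isArtinian R M
  exact ⟨s.length, s.toFun, h0, h1, fun i => s.step i⟩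

local notation "J" => Ring.jacobson R

theorem jac_nil [IsArtinianRing R] : ∃ n : ℕ, (J) ^ n = ⊥ := by
  obtain ⟨n, hn⟩ := IsSemiprimaryRing.isNilpotent (R := R)
  exact ⟨n, hn⟩

theorem jac_isNilpotent [IsArtinianRing R] {x : R} (hx : x ∈ J) : IsNilpotent x := by
  obtain ⟨n, hn⟩ := jac_nil (R := R)
  refine ⟨n, ?_⟩
  have : x ^ n ∈ (J) ^ n := Ideal.pow_mem_pow hx n
  rwa [hn] at this

theorem jac_inv [IsArtinianRing R] {x : R} (hx : x ∈ J) : ∃ g : R, g * (1 - x) = 1 ∧ (1 - x) * g = 1 := by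
  obtain ⟨g, hg⟩ := (jac_isNilpotent hx).isUnit_one_sub
  exact ⟨↑g⁻¹, by rw [← hg]; simp, by rw [← hg]; simp⟩

theorem jac_mul_left {x : R} (r : R) (hx : x ∈ J) : r * x ∈ J := Ideal.mul_mem_left _ r hx
theorem jac_mul_right {x : R} (r : R) (hx : x ∈ J) : x * r ∈ J := Ideal.mul_mem_right r _ hx

theorem jac_kill {V : Type u} [AddCommGroup V] [Module R V] [IsSimpleModule R V] {x : R} (hx : x ∈ J)
    (v : V) : x • v = 0 :=
  Module.mem_annihilator.1 (IsSemisimpleModule.jacobson_le_annihilator R V hx) v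

/-- iterating `y = a y b` with `b` in the radical -/
theorem zero_of_eq_mul [IsArtinianRing R] {y a b : R} (hb : b ∈ J) (h : y = a * y * b) : y = 0 := by
  obtain ⟨n, hn⟩ := jac_isNilpotent hb
  have : ∀ k : ℕ, y = a ^ k * y * b ^ k := by
    intro k
    induction k with
    | zero => simp
    | succ k ih =>
      calc y = a ^ k * y * b ^ k := ih
        _ = a ^ k * (a * y * b) * b ^ k := by rw [← h]
        _ = _ := by rw [pow_succ, pow_succ']; noncomm_ring
  rw [this n, hn, mul_zero]

/-- a uniserial idempotent -/
structure Uni (e : R) : Prop where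
  idem : e * e = e
  comp : ∀ x y, x * e = x → y * e = y → (∃ t, x = t * y) ∨ ∃ t, y = t * x
  ne : e ≠ 0

theorem Uni.mem_or {e : R} (he : Uni e) {z : R} (hz : z * e = z) : z ∈ J ∨ ∃ v, v * z = e := by
  by_cases hv : ∃ v, v * z = e
  · exact Or.inr hv
  left
  rw [Ring.jacobson_eq_sInf_isMaximal, Submodule.mem_sInf]
  intro m hm
  by_contra hzm
  obtain ⟨r, w, hw, h1⟩ : ∃ r, ∃ w ∈ m, r * z + w = 1 := by
    have h2 : m ⊔ Ideal.span {z} = ⊤ := by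
      apply (Ideal.isMaximal_def.1 hm).2
      rw [left_lt_sup]
      intro h; exact hzm (h (Ideal.mem_span_singleton_self z))
    have h3 : (1 : R) ∈ m ⊔ Ideal.span {z} := by rw [h2]; trivial
    obtain ⟨w, hw, y, hy, h4⟩ := Submodule.mem_sup.1 h3
    obtain ⟨r, rfl⟩ := Ideal.mem_span_singleton'.1 hy
    exact ⟨r, w, hw, by rw [add_comm]; exact h4⟩
  have hew : e * w = e - e * r * z := by
    have h5 : e * (r * z + w) = e := by rw [h1, mul_one]
    rw [mul_add, ← mul_assoc] at h5
    exact eq_sub_of_add_eq' h5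
  rcases he.comp z (e * w) hz (by rw [hew, sub_mul, he.idem, mul_assoc _ z, hz]) with ⟨t, ht⟩ | ⟨t, ht⟩
  · apply hzm; rw [ht, ← mul_assoc]; exact Ideal.mul_mem_left _ _ hw
  · apply hv
    refine ⟨t + e * r, ?_⟩
    rw [add_mul, ← ht, hew]; abel

theorem Uni.notMem [IsArtinianRing R] {e : R} (he : Uni e) : e ∉ J := by
  intro h
  obtain ⟨g, hg, -⟩ := jac_inv h
  apply he.ne
  calc e = g * (1 - e) * e := by rw [hg, one_mul]
    _ = 0 := by rw [mul_assoc, sub_mul, one_mul, he.idem, sub_self, mul_zero]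

/-- inverses in corners -/
theorem Uni.inv [IsArtinianRing R] {e : R} (he : Uni e) {u : R} (h1 : e * u = u) (h2 : u * e = u) (hu : u ∉ J) :
    ∃ v, e * v = v ∧ v * e = v ∧ v * u = e ∧ u * v = e := by
  have key : ∀ u, u * e = u → e * u = u → u ∉ J → ∃ v, e * v = v ∧ v * e = v ∧ v * u = e := by
    intro u h2 h1 hu
    obtain ⟨v, hv⟩ := (he.mem_or h2).resolve_left hu
    refine ⟨e * v * e, by simp only [← mul_assoc, he.idem], by simp only [mul_assoc, he.idem], ?_⟩
    rw [mul_assoc, h1, mul_assoc, hv, he.idem]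
  obtain ⟨v, hv1, hv2, hv3⟩ := key u h2 h1 hu
  have hvJ : v ∉ J := fun h => he.notMem (hv3 ▸ jac_mul_right u h)
  obtain ⟨w, hw1, hw2, hw3⟩ := key v hv2 hv1 hvJ
  refine ⟨v, hv1, hv2, hv3, ?_⟩
  have : w = u := by
    calc w = w * e := hw2.symm
      _ = w * v * u := by rw [← hv3, mul_assoc]
      _ = u := by rw [hw3, h1]
  rw [← this, hw3]

/-- Core of right comparability. -/
theorem rcomp_core [IsArtinianRing R] {ei ek ej x y : R} (hi : Uni ei) (hk : Uni ek) (hj : Uni ej)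
    (hx1 : ej * x = x) (hx2 : x * ei = x) (hy1 : ej * y = y) (hy2 : y * ek = y)
    {M : Type u} [AddCommGroup M] [Module R M] (q1 q2 : M) (hq1 : ei • q1 = q1) (hq2 : ek • q2 = q2)
    (hgen : ∀ m : M, ∃ r t : R, m = r • q1 + t • q2)
    (hrel : x • q1 + y • q2 = 0)
    (hrels : ∀ r t : R, r • q1 + t • q2 = 0 → ∃ w, r * ei = w * x ∧ t * ek = w * y)
    (A B : Submodule R M) (hAB : Disjoint A B) (a1 a2 b1 b2 : M) (ha1 : a1 ∈ A) (ha2 : a2 ∈ A)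
    (hb1 : b1 ∈ B) (hb2 : b2 ∈ B) (h1 : q1 = a1 + b1) (h2 : q2 = a2 + b2) (hb20 : b2 ≠ 0)
    (s0 : R) (hs0 : b1 = s0 • b2) : (∃ t, x = y * t) ∨ ∃ t, y = x * t := by
  have uniq : ∀ a ∈ A, ∀ b ∈ B, a + b = 0 → a = 0 ∧ b = 0 := by
    intro a ha b hb hab
    have : a = -b := eq_neg_of_add_eq_zero_left hab
    have ha0 : a = 0 := by
      have hA : a ∈ A ⊓ B := ⟨ha, this ▸ B.neg_mem hb⟩
      rw [hAB.eq_bot] at hA; exact hA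
    exact ⟨ha0, by rw [ha0, zero_add] at hab; exact hab⟩
  have hfix : ∀ (e : R) (q a b : M), e • q = q → q = a + b → a ∈ A → b ∈ B → e • a = a ∧ e • b = b := by
    intro e q a b he hq ha hb
    have := uniq (e • a - a) (A.sub_mem (A.smul_mem _ ha) ha) (e • b - b) (B.sub_mem (B.smul_mem _ hb) hb)
      (by rw [hq, smul_add] at he
          rw [show e • a - a + (e • b - b) = (e • a + e • b) - (a + b) by abel, he, sub_self])
    exact ⟨sub_eq_zero.1 this.1, sub_eq_zero.1 this.2⟩
  obtain ⟨ea1, eb1⟩ := hfix ei q1 a1 b1 hq1 h1 ha1 hb1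
  obtain ⟨ea2, eb2⟩ := hfix ek q2 a2 b2 hq2 h2 ha2 hb2
  obtain ⟨s, hs, hs1, hs2⟩ : ∃ s : R, b1 = s • b2 ∧ ei * s = s ∧ s * ek = s :=
    ⟨ei * s0 * ek, by rw [mul_smul, mul_smul, eb2, ← hs0, eb1],
      by simp only [← mul_assoc, hi.idem], by simp only [mul_assoc, hk.idem]⟩
  clear hs0
  set q := q1 - s • q2 with hq
  have hqA : q ∈ A := by
    have : q = a1 - s • a2 := by rw [hq, h1, h2, hs, smul_add]; abel
    rw [this]; exact A.sub_mem ha1 (A.smul_mem _ ha2)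
  have hqe : ei • q = q := by rw [hq, smul_sub, hq1, ← mul_smul, hs1]
  obtain ⟨r, t, hrt⟩ : ∃ r t : R, a2 = r • q + t • q2 := by
    obtain ⟨r, t, h⟩ := hgen a2
    exact ⟨r, t + r * s, by rw [h, hq, smul_sub, add_smul, mul_smul]; abel⟩
  have htb : t • b2 = 0 := by
    refine (uniq (r • q + t • a2 - a2) ?_ (t • b2) (B.smul_mem _ hb2) ?_).2
    · exact A.sub_mem (A.add_mem (A.smul_mem _ hqA) (A.smul_mem _ ha2)) ha2
    · conv_lhs => rw [show r • q + t • a2 - a2 + t • b2 = r • q + t • (a2 + b2) - a2 by rw [smul_add]; abel]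
      rw [← h2, ← hrt, sub_self]
  have htJ : t * ek ∈ J := by
    refine (hk.mem_or (by rw [mul_assoc, hk.idem])).resolve_right ?_
    rintro ⟨v, hv⟩
    apply hb20
    rw [← eb2, ← hv, mul_smul, mul_smul, eb2, htb, smul_zero]
  obtain ⟨g, hg, -⟩ := jac_inv htJ
  obtain ⟨r', hr', hr1, hr2⟩ : ∃ r' : R, a2 = r' • q ∧ ek * r' = r' ∧ r' * ei = r' := by
    refine ⟨ek * (g * r) * ei, ?_, by simp only [← mul_assoc, hk.idem], by simp only [mul_assoc, hi.idem]⟩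
    have h3 : (1 - t * ek) • a2 = r • q := by
      rw [sub_smul, one_smul, mul_smul, ea2]
      nth_rewrite 1 [hrt]
      rw [h2, smul_add, htb]; abel
    rw [mul_smul, hqe, mul_smul, mul_smul, ← h3, ← mul_smul g, hg, one_smul, ea2]
  set Y := x * s + y with hY
  have hYb : Y • b2 = 0 := by
    refine (uniq (x • q + Y • a2) (A.add_mem (A.smul_mem _ hqA) (A.smul_mem _ ha2)) (Y • b2)
      (B.smul_mem _ hb2) ?_).2
    rw [add_assoc, ← smul_add, ← h2, ← hrel, hq, hY, smul_sub, add_smul, mul_smul]; abel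
  have hrel2 : (-(Y * r')) • q1 + (Y + Y * r' * s) • q2 = 0 := by
    have : Y • (q2 - r' • q) = 0 := by rw [← hr', h2, add_sub_cancel_left, hYb]
    rw [← this, hq]
    simp only [smul_sub, neg_smul, add_smul, mul_smul]; abel
  obtain ⟨w0, hw1, hw2⟩ := hrels _ _ hrel2
  have hYk : Y * ek = Y := by rw [hY, add_mul, mul_assoc, hs2, hy2]
  have hYj : ej * Y = Y := by rw [hY, mul_add, ← mul_assoc, hx1, hy1]
  rw [neg_mul, mul_assoc, hr2] at hw1
  rw [add_mul, hYk, mul_assoc, hs2] at hw2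
  obtain ⟨w, hwx, hwy, hwl, hwr⟩ : ∃ w, -(Y * r') = w * x ∧ Y + Y * r' * s = w * y ∧ ej * w = w ∧ w * ej = w := by
    refine ⟨ej * w0 * ej, ?_, ?_, by simp only [← mul_assoc, hj.idem], by simp only [mul_assoc, hj.idem]⟩
    · rw [mul_assoc, hx1, mul_assoc, ← hw1, mul_neg, ← mul_assoc, hYj]
    · rw [mul_assoc (ej * w0), hy1, mul_assoc ej, ← hw2, mul_add, hYj, ← mul_assoc, ← mul_assoc, hYj]
  have hwY : w * Y = Y := by
    rw [hY, mul_add, ← mul_assoc, ← hwx, ← hwy, ← hY]; noncomm_ring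
  by_cases hc : ej - w ∈ J
  · have hwJ : w ∉ J := fun h => hj.notMem (by have := Ideal.add_mem _ hc h; simpa using this)
    obtain ⟨v, hv1, hv2, hv3, hv4⟩ := hj.inv hwl hwr hwJ
    have hvY : v * Y = Y := by rw [← hwY, ← mul_assoc, hv3, hYj, hwY]
    have hx : x = -(Y * r') := by
      rw [← hx1, ← hv3, mul_assoc, ← hwx, mul_neg, ← mul_assoc, hvY]
    have hy : y = Y + Y * r' * s := by
      rw [← hy1, ← hv3, mul_assoc, ← hwy, mul_add, ← mul_assoc, ← mul_assoc, hvY]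
    by_cases hrs : r' * s ∈ J
    · left
      obtain ⟨g, -, hg⟩ := jac_inv (neg_mem hrs)
      refine ⟨-(g * r'), ?_⟩
      have hYy : Y = y * g := by
        rw [hy, show Y + Y * r' * s = Y * (1 - -(r' * s)) by noncomm_ring, mul_assoc, hg, mul_one]
      rw [mul_neg, ← mul_assoc, ← hYy]; exact hx
    · right
      obtain ⟨g, -, -, -, hg⟩ := hk.inv (u := r' * s) (by rw [← mul_assoc, hr1]) (by rw [mul_assoc, hs2]) hrs
      have hYx : Y = x * (-(s * g)) := by
        rw [hx, neg_mul_neg, mul_assoc, ← mul_assoc r', hg, hYk]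
      exact ⟨-(s * g) * (1 + r' * s), by rw [← mul_assoc, ← hYx, hy]; noncomm_ring⟩
  · obtain ⟨v, -, -, hv3, -⟩ := hj.inv (u := ej - w) (by rw [mul_sub, hj.idem, hwl]) (by rw [sub_mul, hj.idem, hwr]) hc
    have hY0 : Y = 0 := by
      rw [← hYj, ← hv3, mul_assoc, sub_mul, hYj, hwY, sub_self, mul_zero]
    right
    exact ⟨-s, by rw [mul_neg]; exact (eq_neg_of_add_eq_zero_right hY0)⟩

theorem exists_indec_summand [IsArtinianRing R] (M : Type u) [AddCommGroup M] [Module R M]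
    [Module.Finite R M] [Nontrivial M] : ∃ A B : Submodule R M, IsCompl A B ∧ IsIndecomposableMod R B := by
  obtain ⟨B, ⟨hB0, A, hAB⟩, hmin⟩ := WellFounded.has_min (r := (· < · : Submodule R M → Submodule R M → Prop))
    wellFounded_lt {B | B ≠ ⊥ ∧ ∃ A, IsCompl A B} ⟨⊤, top_ne_bot, ⊥, isCompl_bot_top⟩
  refine ⟨A, B, hAB, Submodule.nontrivial_iff_ne_bot.2 hB0, ?_⟩
  intro N N' hN
  by_contra hc
  push Not at hc
  have hd : Disjoint (N.map B.subtype) (N'.map B.subtype) :=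
    (Submodule.disjoint_map B.injective_subtype hN.disjoint)
  have hs : N.map B.subtype ⊔ N'.map B.subtype = B := by
    rw [← Submodule.map_sup, hN.sup_eq_top, Submodule.map_subtype_top]
  have hlt : N.map B.subtype < B := by
    refine lt_of_le_of_ne (Submodule.map_subtype_le _ _) ?_
    intro h
    rw [h] at hd
    have : N'.map B.subtype = ⊥ := by
      have := hd.eq_bot_of_ge (Submodule.map_subtype_le _ _); exact this
    exact hc.2 (Submodule.map_injective_of_injective B.injective_subtype (by rw [this, Submodule.map_bot]))
  refine hmin _ ⟨?_, N'.map B.subtype ⊔ A, ?_⟩ hlt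
  · intro h
    exact hc.1 (Submodule.map_injective_of_injective B.injective_subtype (by rw [h, Submodule.map_bot]))
  · symm
    refine ⟨Disjoint.disjoint_sup_right_of_disjoint_sup_left hd (by rw [hs]; exact hAB.disjoint.symm), ?_⟩
    rw [codisjoint_iff, ← sup_assoc, hs, sup_comm, hAB.sup_eq_top]

/-- Right comparability. -/
theorem rcomp_of_nakayama [hN : IsNakayama R] {ei ek ej x y : R} (hi : Uni ei) (hk : Uni ek) (hj : Uni ej)
    (hx1 : ej * x = x) (hx2 : x * ei = x) (hy1 : ej * y = y) (hy2 : y * ek = y) :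
    (∃ t, x = y * t) ∨ ∃ t, y = x * t := by
  have : IsArtinianRing R := hN.artinian
  let N : Submodule R (R × R) :=
    { carrier := {z | ∃ w, z.1 * ei = w * x ∧ z.2 * ek = w * y}
      add_mem' := by
        rintro a b ⟨w, h1, h2⟩ ⟨w', h1', h2'⟩
        exact ⟨w + w', by simp [add_mul, h1, h1'], by simp [add_mul, h2, h2']⟩
      zero_mem' := ⟨0, by simp, by simp⟩
      smul_mem' := by
        rintro c a ⟨w, h1, h2⟩
        exact ⟨c * w, by simp [mul_assoc, h1], by simp [mul_assoc, h2]⟩ }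
  have hmem : ∀ r t : R, ((r, t) : R × R) ∈ N ↔ ∃ w, r * ei = w * x ∧ t * ek = w * y := fun r t => Iff.rfl
  let q1 : (R × R) ⧸ N := N.mkQ (1, 0)
  let q2 : (R × R) ⧸ N := N.mkQ (0, 1)
  have hcomb : ∀ r t : R, r • q1 + t • q2 = N.mkQ (r, t) := by
    intro r t
    simp only [q1, q2]
    rw [← map_smul, ← map_smul, ← map_add]; simp
  by_cases hx : x ∈ J
  swap
  · -- x is a unit
    right
    obtain ⟨v, hv⟩ := (hi.mem_or hx2).resolve_left hx
    have hz : (x * (ei * v)) * (x * (ei * v)) = x * (ei * v) := by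
      rw [show (x * (ei * v)) * (x * (ei * v)) = x * ei * (v * x) * (ei * v) by noncomm_ring, hv]
      rw [mul_assoc x, hi.idem, mul_assoc, ← mul_assoc ei, hi.idem]
    set z := x * (ei * v) * ej with hzdef
    have hzz : z * z = z := by
      rw [hzdef, show x * (ei * v) * ej * (x * (ei * v) * ej) = x * (ei * v) * (ej * x) * (ei * v) * ej by noncomm_ring, hx1,
        show x * (ei * v) * x * (ei * v) * ej = (x * (ei * v)) * (x * (ei * v)) * ej by noncomm_ring, hz]
    have hzx : z * x = x := by
      rw [hzdef, mul_assoc, hx1, mul_assoc, mul_assoc, hv, hi.idem, hx2]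
    have hzJ : z ∉ J := by
      intro h
      apply hx; rw [← hzx]; exact jac_mul_right _ h
    obtain ⟨g, -, -, hg, -⟩ := hj.inv (u := z) (by rw [hzdef, ← mul_assoc, ← mul_assoc, hx1]) (by rw [hzdef, mul_assoc, hj.idem]) hzJ
    have hze : z = ej := by
      calc z = ej * z := by rw [hzdef, mul_assoc x, ← mul_assoc ej, hx1]
        _ = g * (z * z) := by rw [← hg, mul_assoc]
        _ = ej := by rw [hzz, hg]
    refine ⟨ei * v * ej * y, ?_⟩
    calc y = z * y := by rw [hze, hy1]
      _ = _ := by rw [hzdef]; noncomm_ring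
  have hnt : Nontrivial ((R × R) ⧸ N) := by
    refine ⟨q1, 0, ?_⟩
    intro h
    change N.mkQ (1, 0) = 0 at h
    rw [Submodule.mkQ_apply, Submodule.Quotient.mk_eq_zero, hmem] at h
    obtain ⟨w, hw, -⟩ := h
    rw [one_mul] at hw
    exact hi.notMem (hw ▸ jac_mul_left _ hx)
  obtain ⟨A, B, hAB, hB⟩ := exists_indec_summand (R := R) ((R × R) ⧸ N)
  have hBs := hN.serial B (hasLength_of_finite B) hB
  have hgen : ∀ m : (R × R) ⧸ N, ∃ r t : R, m = r • q1 + t • q2 := by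
    intro m
    obtain ⟨⟨r, t⟩, rfl⟩ := N.mkQ_surjective m
    exact ⟨r, t, (hcomb r t).symm⟩
  have hdec : ∀ m : (R × R) ⧸ N, ∃ a ∈ A, ∃ b ∈ B, m = a + b := by
    intro m
    have : m ∈ A ⊔ B := by rw [hAB.sup_eq_top]; trivial
    obtain ⟨a, ha, b, hb, h⟩ := Submodule.mem_sup.1 this
    exact ⟨a, ha, b, hb, h.symm⟩
  obtain ⟨a1, ha1, b1, hb1, h1⟩ := hdec q1
  obtain ⟨a2, ha2, b2, hb2, h2⟩ := hdec q2
  have hq1 : ei • q1 = q1 := by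
    have : ei • q1 - q1 = N.mkQ (ei - 1, 0) := by
      rw [← hcomb]; simp [sub_smul]
    rw [← sub_eq_zero, this, Submodule.mkQ_apply, Submodule.Quotient.mk_eq_zero, hmem]
    exact ⟨0, by rw [sub_mul, hi.idem]; simp, by simp⟩
  have hq2 : ek • q2 = q2 := by
    have : ek • q2 - q2 = N.mkQ (0, ek - 1) := by
      rw [← hcomb]; simp [sub_smul]
    rw [← sub_eq_zero, this, Submodule.mkQ_apply, Submodule.Quotient.mk_eq_zero, hmem]
    exact ⟨0, by simp, by rw [sub_mul, hk.idem]; simp⟩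
  have hrel : x • q1 + y • q2 = 0 := by
    rw [hcomb, Submodule.mkQ_apply, Submodule.Quotient.mk_eq_zero, hmem]
    exact ⟨ej, by rw [hx1, hx2], by rw [hy1, hy2]⟩
  have hrels : ∀ r t : R, r • q1 + t • q2 = 0 → ∃ w, r * ei = w * x ∧ t * ek = w * y := by
    intro r t h
    rwa [hcomb, Submodule.mkQ_apply, Submodule.Quotient.mk_eq_zero, hmem] at h
  have hne : ¬ (b1 = 0 ∧ b2 = 0) := by
    rintro ⟨hb1, hb2⟩
    subst hb1 hb2
    rw [add_zero] at h1 h2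
    have hA : A = ⊤ := by
      rw [eq_top_iff]
      intro m _
      obtain ⟨r, t, rfl⟩ := hgen m
      exact A.add_mem (A.smul_mem _ (h1 ▸ ha1)) (A.smul_mem _ (h2 ▸ ha2))
    have := hAB.disjoint
    rw [hA, disjoint_comm, disjoint_top] at this
    exact (Submodule.nontrivial_iff_ne_bot.1 hB.1) this
  have hcmp : (∃ s : R, b1 = s • b2) ∨ ∃ s : R, b2 = s • b1 := by
    rcases hBs (Submodule.span R {⟨b1, hb1⟩}) (Submodule.span R {⟨b2, hb2⟩}) with h | h
    · left
      obtain ⟨s, hs⟩ := Submodule.mem_span_singleton.1 (h (Submodule.mem_span_singleton_self _))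
      exact ⟨s, (congrArg Subtype.val hs).symm⟩
    · right
      obtain ⟨s, hs⟩ := Submodule.mem_span_singleton.1 (h (Submodule.mem_span_singleton_self _))
      exact ⟨s, (congrArg Subtype.val hs).symm⟩
  rcases hcmp with ⟨s, hs⟩ | ⟨s, hs⟩
  · have hb0 : b2 ≠ 0 := by
      intro h; exact hne ⟨by rw [hs, h, smul_zero], h⟩
    exact rcomp_core hi hk hj hx1 hx2 hy1 hy2 q1 q2 hq1 hq2 hgen hrel hrels A B hAB.disjoint a1 a2 b1 b2
      ha1 ha2 hb1 hb2 h1 h2 hb0 s hs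
  · have hb0 : b1 ≠ 0 := by
      intro h; exact hne ⟨h, by rw [hs, h, smul_zero]⟩
    exact (rcomp_core hk hi hj hy1 hy2 hx1 hx2 q2 q1 hq2 hq1
      (fun m => by obtain ⟨r, t, h⟩ := hgen m; exact ⟨t, r, by rw [h, add_comm]⟩)
      (by rw [add_comm, hrel])
      (fun r t h => by
        obtain ⟨w, h1, h2⟩ := hrels t r (by rw [add_comm, h]); exact ⟨w, h2, h1⟩)
      A B hAB.disjoint a2 a1 b2 b1
      ha2 ha1 hb2 hb1 h2 h1 hb0 s hs).symm

end Ringy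

section Build
variable {R : Type u} [Ring R]
local notation "J" => Ring.jacobson R

/-- A simple module `V` with `e V ≠ 0`. -/
def HasType (e : R) (V : Type u) [AddCommGroup V] [Module R V] : Prop :=
  IsSimpleModule R V ∧ ∃ v : V, v ≠ 0 ∧ e • v = v

theorem HasType.congr {e : R} {V W : Type u} [AddCommGroup V] [Module R V] [AddCommGroup W] [Module R W]
    (φ : V ≃ₗ[R] W) (h : HasType e V) : HasType e W := by
  obtain ⟨h1, v, h2, h3⟩ := h
  refine ⟨(LinearEquiv.isSimpleModule_iff φ).1 h1, φ v, by simpa using h2, by rw [← map_smul, h3]⟩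

theorem HasType.equiv {e : R} (he : Uni e) {V W : Type u} [AddCommGroup V] [Module R V] [AddCommGroup W] [Module R W]
    (hV : HasType e V) (hW : HasType e W) : Nonempty (V ≃ₗ[R] W) := by
  have key : ∀ (V W : Type u) [AddCommGroup V] [Module R V] [AddCommGroup W] [Module R W] (v : V) (w : W),
      IsSimpleModule R V → IsSimpleModule R W → v ≠ 0 → e • v = v → w ≠ 0 → e • w = w → ∀ r : R, r • v = 0 → r • w = 0 := by
    intro V W _ _ _ _ v w _ _ hv hev hw hew r hr
    rcases he.mem_or (z := r * e) (by rw [mul_assoc, he.idem]) with h | ⟨t, ht⟩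
    · rw [← hew, ← mul_smul]; exact jac_kill h w
    · exfalso; apply hv
      rw [← hev, ← ht, mul_smul, mul_smul, hev, hr, smul_zero]
  obtain ⟨hV1, v, hv, hev⟩ := hV
  obtain ⟨hW1, w, hw, hew⟩ := hW
  have hker : LinearMap.ker (LinearMap.toSpanSingleton R V v) = LinearMap.ker (LinearMap.toSpanSingleton R W w) := by
    ext r
    simp only [LinearMap.mem_ker, LinearMap.toSpanSingleton_apply]
    exact ⟨key V W v w hV1 hW1 hv hev hw hew r, key W V w v hW1 hV1 hw hew hv hev r⟩
  exact ⟨((LinearMap.quotKerEquivOfSurjective _ (IsSimpleModule.toSpanSingleton_surjective R hv)).symm.trans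
    (Submodule.quotEquivOfEq _ _ hker)).trans
    (LinearMap.quotKerEquivOfSurjective _ (IsSimpleModule.toSpanSingleton_surjective R hw))⟩

theorem exists_uni [hN : IsNakayama R] (V : Type u) [AddCommGroup V] [Module R V] (hV : IsSimpleModule R V) :
    ∃ e : R, Uni e ∧ IsIndecomposableMod R (Ideal.span {e} : Ideal R) ∧ HasType e V := by
  have : IsArtinianRing R := hN.artinian
  have : Nontrivial V := IsSimpleModule.nontrivial R V
  obtain ⟨v0, hv0⟩ := exists_ne (0 : V)
  obtain ⟨I, ⟨e, he, ⟨v, hv⟩, rfl⟩, hmin⟩ := WellFounded.has_min (r := (· < · : Ideal R → Ideal R → Prop))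
    wellFounded_lt {I | ∃ e : R, e * e = e ∧ (∃ v : V, e • v ≠ 0) ∧ I = Ideal.span {e}} ⟨_, 1, by simp, ⟨v0, by simpa using hv0⟩, rfl⟩
  have hmemE : ∀ x : R, x ∈ Ideal.span {e} ↔ x * e = x := by
    intro x
    rw [Ideal.mem_span_singleton']
    constructor
    · rintro ⟨a, rfl⟩; rw [mul_assoc, he]
    · intro h; exact ⟨x, h⟩
  have hee : e ∈ Ideal.span {e} := Ideal.mem_span_singleton_self e
  have hne : e ≠ 0 := by rintro rfl; simp at hv
  have hind : IsIndecomposableMod R (Ideal.span {e} : Ideal R) := by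
    refine ⟨⟨⟨e, hee⟩, 0, fun h => hne (congrArg Subtype.val h)⟩, ?_⟩
    have main : ∀ N N' : Submodule R (Ideal.span {e} : Ideal R), IsCompl N N' → ∀ n ∈ N, ∀ n' ∈ N',
        e = n.1 + n'.1 → n.1 • v ≠ 0 → N' = ⊥ := by
      intro N N' hNN n hn n' hn' hsum hnv
      have hne1 : n.1 * e = n.1 := (hmemE _).1 n.2
      have h1 : n.1 * n'.1 = 0 := by
        have h2 : n.1 • n' = n - n.1 • n := by
          ext1
          simp only [SetLike.val_smul, smul_eq_mul, AddSubgroupClass.coe_sub]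
          rw [eq_sub_iff_add_eq, add_comm, ← mul_add, ← hsum, hne1]
        have h3 : n.1 • n' ∈ N ⊓ N' := ⟨h2 ▸ N.sub_mem hn (N.smul_mem _ hn), N'.smul_mem _ hn'⟩
        rw [hNN.inf_eq_bot] at h3
        exact congrArg Subtype.val ((Submodule.mem_bot R).1 h3)
      have hnn : n.1 * n.1 = n.1 := by
        have h4 : n.1 * e = n.1 * n.1 + n.1 * n'.1 := by rw [← mul_add, ← hsum]
        rw [h1, add_zero, hne1] at h4; exact h4.symm
      have hnot := hmin (Ideal.span {n.1}) ⟨n.1, hnn, ⟨v, hnv⟩, rfl⟩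
      have hle : Ideal.span {n.1} ≤ Ideal.span {e} := by
        rw [Ideal.span_singleton_le_iff_mem]; exact n.2
      have heq : Ideal.span {n.1} = Ideal.span {e} := by
        by_contra hc; exact hnot (lt_of_le_of_ne hle hc)
      have hen : e ∈ Ideal.span {n.1} := by rw [heq]; exact hee
      obtain ⟨a, ha⟩ := Ideal.mem_span_singleton'.1 hen
      have htop : N = ⊤ := by
        rw [eq_top_iff]
        rintro ⟨x, hx⟩ -
        have : (⟨x, hx⟩ : (Ideal.span {e} : Ideal R)) = (x * a) • n := by
          ext1; simp only [SetLike.val_smul, smul_eq_mul]; rw [mul_assoc, ha, (hmemE x).1 hx]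
        rw [this]; exact N.smul_mem _ hn
      have := hNN.disjoint
      rw [htop, disjoint_comm, disjoint_top] at this; exact this
    intro N N' hNN
    have : (⟨e, hee⟩ : (Ideal.span {e} : Ideal R)) ∈ N ⊔ N' := by rw [hNN.sup_eq_top]; trivial
    obtain ⟨n, hn, n', hn', hsum⟩ := Submodule.mem_sup.1 this
    have hsum' : n.1 + n'.1 = e := congrArg Subtype.val hsum
    by_cases h : n.1 • v = 0
    · left
      refine main N' N hNN.symm n' hn' n hn (by rw [add_comm, hsum']) ?_
      intro h'
      apply hv; rw [← hsum', add_smul, h, h', add_zero]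
    · right
      exact main N N' hNN n hn n' hn' hsum'.symm h
  refine ⟨e, ⟨he, ?_, hne⟩, hind, hV, e • v, hv, by rw [← mul_smul, he]⟩
  have huni := hN.serial _ (hasLength_of_finite _) hind
  intro x y hx hy
  rcases huni (Submodule.span R {⟨x, (hmemE x).2 hx⟩}) (Submodule.span R {⟨y, (hmemE y).2 hy⟩}) with h | h
  · left
    obtain ⟨s, hs⟩ := Submodule.mem_span_singleton.1 (h (Submodule.mem_span_singleton_self _))
    exact ⟨s, (congrArg Subtype.val hs).symm⟩
  · right
    obtain ⟨s, hs⟩ := Submodule.mem_span_singleton.1 (h (Submodule.mem_span_singleton_self _))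
    exact ⟨s, (congrArg Subtype.val hs).symm⟩

/-- A basic set of idempotents for a serial ring. -/
structure Bas (R : Type u) [Ring R] (s : ℕ) where
  e : Fin s → R
  uni : ∀ i, Uni (e i)
  indec : ∀ i, IsIndecomposableMod R (Ideal.span {e i} : Ideal R)
  types : ∀ (V : Type u) [AddCommGroup V] [Module R V], IsSimpleModule R V → ∃ i, HasType (e i) V
  sep : ∀ i k v, i ≠ k → e k * v = v → v * e i = v → v ∈ Ring.jacobson R
  full : (1 : R) ∈ AddSubgroup.closure {t : R | ∃ r i s, t = r * e i * s}
  rcomp : ∀ i k j x y, e j * x = x → x * e i = x → e j * y = y → y * e k = y →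
    (∃ t, x = y * t) ∨ ∃ t, y = x * t
  jne : ∀ i, ∃ x ∈ Ring.jacobson R, x * e i = x ∧ x ≠ 0

theorem full_aux {ι : Type} (e : ι → R) (h : ∀ (V : Type u) [AddCommGroup V] [Module R V], IsSimpleModule R V → ∃ i, HasType (e i) V) :
    (1 : R) ∈ AddSubgroup.closure {t : R | ∃ r i s, t = r * e i * s} := by
  let I : Ideal R :=
    { AddSubgroup.closure {t : R | ∃ r i s, t = r * e i * s} with
      smul_mem' := by
        intro c x hx
        change x ∈ AddSubgroup.closure _ at hx
        change c * x ∈ AddSubgroup.closure _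
        induction hx using AddSubgroup.closure_induction with
        | mem t ht =>
          obtain ⟨r, i, s, rfl⟩ := ht
          exact AddSubgroup.subset_closure ⟨c * r, i, s, by noncomm_ring⟩
        | zero => rw [mul_zero]; exact AddSubgroup.zero_mem _
        | add _ _ _ _ h1 h2 => rw [mul_add]; exact AddSubgroup.add_mem _ h1 h2
        | neg _ _ h1 => rw [mul_neg]; exact AddSubgroup.neg_mem _ h1 }
  change (1 : R) ∈ I
  rw [← Ideal.eq_top_iff_one]
  by_contra hI
  obtain ⟨m, hm, hIm⟩ := Ideal.exists_le_maximal I hI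
  have hs : IsSimpleModule R (R ⧸ m) := isSimpleModule_iff_isCoatom.2 (Ideal.isMaximal_def.1 hm)
  obtain ⟨i, -, v, hv, hev⟩ := h (R ⧸ m) hs
  obtain ⟨r, rfl⟩ := Submodule.mkQ_surjective m v
  apply hv
  rw [← hev, ← map_smul, Submodule.mkQ_apply, Submodule.Quotient.mk_eq_zero]
  exact hIm (AddSubgroup.subset_closure ⟨1, i, r, by simp⟩)

theorem mem_span_idem {e : R} (he : e * e = e) (x : R) : x ∈ Ideal.span {e} ↔ x * e = x := by
  rw [Ideal.mem_span_singleton']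
  constructor
  · rintro ⟨a, rfl⟩; rw [mul_assoc, he]
  · intro h; exact ⟨x, h⟩

theorem projective_span_idem {e : R} (he : e * e = e) : Module.Projective R (Ideal.span {e} : Ideal R) := by
  refine Module.Projective.of_split (M := R) (Ideal.span {e} : Ideal R).subtype
    (LinearMap.codRestrict _ (LinearMap.toSpanSingleton R R e) (fun x => ?_)) ?_
  · rw [LinearMap.toSpanSingleton_apply, smul_eq_mul]
    exact Ideal.mem_span_singleton'.2 ⟨x, rfl⟩
  · ext x
    simp [(mem_span_idem he _).1 x.2]

theorem exists_bas [hN : IsNakayama R] (h0 : NoSimpleProjectives R) (s : ℕ) (hs : SimpleCount R s) :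
    Nonempty (Bas R s) := by
  have : IsArtinianRing R := hN.artinian
  obtain ⟨F, hF1, hF2, hF3⟩ := hs
  choose e he hind hty using fun i => exists_uni (R := R) (F i) (hF1 i)
  have htypes : ∀ (V : Type u) [AddCommGroup V] [Module R V], IsSimpleModule R V → ∃ i, HasType (e i) V := by
    intro V _ _ hV
    obtain ⟨i, ⟨φ⟩⟩ := hF3 V hV
    exact ⟨i, (hty i).congr φ.symm⟩
  refine ⟨⟨e, he, hind, htypes, ?_, full_aux e htypes, ?_, ?_⟩⟩
  · intro i k v hik h1 h2
    refine ((he i).mem_or h2).resolve_right ?_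
    rintro ⟨u, hu⟩
    obtain ⟨-, w, hw, hew⟩ := hty i
    have h3 : HasType (e k) (F i) := by
      refine ⟨hF1 i, v • w, ?_, by rw [← mul_smul, h1]⟩
      intro h4
      apply hw; rw [← hew, ← hu, mul_smul, h4, smul_zero]
    obtain ⟨φ⟩ := h3.equiv (he k) (hty k)
    exact (hF2 i k hik).elim φ
  · intro i k j x y h1 h2 h3 h4
    exact rcomp_of_nakayama (he i) (he k) (he j) h1 h2 h3 h4
  · intro i
    by_contra hc
    push Not at hc
    refine h0 (Ideal.span {e i} : Ideal R) ?_ (projective_span_idem (he i).idem)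
    have := (hind i).1
    rw [isSimpleModule_iff_toSpanSingleton_surjective]
    refine ⟨this, ?_⟩
    rintro ⟨z, hz⟩ hz0 ⟨y, hy⟩
    have hz1 := (mem_span_idem (he i).idem z).1 hz
    have hy1 := (mem_span_idem (he i).idem y).1 hy
    rcases (he i).mem_or hz1 with h | ⟨v, hv⟩
    · exact absurd (Subtype.ext (hc z h hz1)) hz0
    · refine ⟨y * v, ?_⟩
      ext1
      simp [mul_assoc, hv, hy1]

end Build

section Paths
variable {R : Type u} [Ring R] [IsArtinianRing R]
local notation "J" => Ring.jacobson R

namespace Bas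
variable {s : ℕ} (D : Bas R s)

theorem idem (i) : D.e i * D.e i = D.e i := (D.uni i).idem

theorem lemG (i : Fin s) (y : R) (hy : y * D.e i = y) : ∃ j r t, y = t * (D.e j * r * y) := by
  have : ∀ t ∈ AddSubgroup.closure {t : R | ∃ r i s, t = r * D.e i * s}, ∃ j r u, t * y = u * (D.e j * r * y) := by
    intro t ht
    induction ht using AddSubgroup.closure_induction with
    | mem t ht => obtain ⟨r, j, s, rfl⟩ := ht; exact ⟨j, s, r, by noncomm_ring⟩
    | zero => exact ⟨i, 0, 0, by simp⟩
    | add a b _ _ h1 h2 =>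
      obtain ⟨j1, r1, u1, h1⟩ := h1
      obtain ⟨j2, r2, u2, h2⟩ := h2
      rcases (D.uni i).comp (D.e j1 * r1 * y) (D.e j2 * r2 * y) (by rw [mul_assoc, hy]) (by rw [mul_assoc, hy]) with ⟨t, ht⟩ | ⟨t, ht⟩
      · exact ⟨j2, r2, u1 * t + u2, by rw [add_mul, h1, h2, ht]; noncomm_ring⟩
      · exact ⟨j1, r1, u1 + u2 * t, by rw [add_mul, h1, h2, ht]; noncomm_ring⟩
    | neg a _ h1 =>
      obtain ⟨j1, r1, u1, h1⟩ := h1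
      exact ⟨j1, r1, -u1, by rw [neg_mul, h1, neg_mul]⟩
  obtain ⟨j, r, u, h⟩ := this 1 D.full
  exact ⟨j, r, u, by rw [← h, one_mul]⟩

theorem lemG' (j : Fin s) (y : R) (hy : D.e j * y = y) : ∃ i r t, y = (y * r * D.e i) * t := by
  have : ∀ t ∈ AddSubgroup.closure {t : R | ∃ r i s, t = r * D.e i * s}, ∃ j r u, y * t = (y * r * D.e j) * u := by
    intro t ht
    induction ht using AddSubgroup.closure_induction with
    | mem t ht => obtain ⟨r, j, s, rfl⟩ := ht; exact ⟨j, r, s, by noncomm_ring⟩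
    | zero => exact ⟨j, 0, 0, by simp⟩
    | add a b _ _ h1 h2 =>
      obtain ⟨j1, r1, u1, h1⟩ := h1
      obtain ⟨j2, r2, u2, h2⟩ := h2
      rcases D.rcomp j1 j2 j (y * r1 * D.e j1) (y * r2 * D.e j2) (by simp only [← mul_assoc, hy])
        (by rw [mul_assoc, D.idem]) (by simp only [← mul_assoc, hy]) (by rw [mul_assoc, D.idem]) with ⟨t, ht⟩ | ⟨t, ht⟩
      · exact ⟨j2, r2, t * u1 + u2, by rw [mul_add, h1, h2, ht]; noncomm_ring⟩
      · exact ⟨j1, r1, u1 + t * u2, by rw [mul_add, h1, h2, ht]; noncomm_ring⟩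
    | neg a _ h1 =>
      obtain ⟨j1, r1, u1, h1⟩ := h1
      exact ⟨j1, r1, -u1, by rw [mul_neg, h1, mul_neg]⟩
  obtain ⟨i, r, u, h⟩ := this 1 D.full
  exact ⟨i, r, u, by rw [← h, mul_one]⟩

theorem exists_arrow (i : Fin s) : ∃ (j : Fin s) (α : R), α ∈ J ∧ D.e j * α = α ∧ α * D.e i = α ∧
    ∀ x ∈ J, x * D.e i = x → ∃ t, x = t * α := by
  obtain ⟨I, ⟨α, hα, hαe, rfl⟩, hmax⟩ := WellFounded.has_min (r := (· > · : Ideal R → Ideal R → Prop))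
    wellFounded_gt {I | ∃ x ∈ J, x * D.e i = x ∧ I = Ideal.span {x}} ⟨_, 0, zero_mem _, by simp, rfl⟩
  obtain ⟨j, r, t, ht⟩ := D.lemG i α hαe
  refine ⟨j, D.e j * r * α, jac_mul_left _ hα, by simp only [← mul_assoc, D.idem], by rw [mul_assoc, hαe], ?_⟩
  intro x hx hxe
  have : ∃ u, x = u * α := by
    rcases (D.uni i).comp x α hxe hαe with h | ⟨u, hu⟩
    · exact h
    · have h1 : Ideal.span {α} ≤ Ideal.span {x} := by
        rw [Ideal.span_singleton_le_iff_mem, Ideal.mem_span_singleton']; exact ⟨u, hu.symm⟩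
      have h2 : x ∈ Ideal.span {α} := by
        by_contra hc
        refine hmax _ ⟨x, hx, hxe, rfl⟩ (lt_of_le_of_ne h1 ?_)
        intro h; rw [h] at hc; exact hc (Ideal.mem_span_singleton_self x)
      obtain ⟨v, hv⟩ := Ideal.mem_span_singleton'.1 h2
      exact ⟨v, hv.symm⟩
  obtain ⟨u, hu⟩ := this
  exact ⟨u * t, by rw [hu, mul_assoc, ← ht]⟩

noncomputable def τ (i : Fin s) : Fin s := (D.exists_arrow i).choose
noncomputable def α (i : Fin s) : R := (D.exists_arrow i).choose_spec.choose
theorem α_mem (i) : D.α i ∈ J := (D.exists_arrow i).choose_spec.choose_spec.1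
theorem e_α (i) : D.e (D.τ i) * D.α i = D.α i := (D.exists_arrow i).choose_spec.choose_spec.2.1
theorem α_e (i) : D.α i * D.e i = D.α i := (D.exists_arrow i).choose_spec.choose_spec.2.2.1
theorem α_gen (i) : ∀ x ∈ J, x * D.e i = x → ∃ t, x = t * D.α i := (D.exists_arrow i).choose_spec.choose_spec.2.2.2
theorem α_ne (i) : D.α i ≠ 0 := by
  intro h
  obtain ⟨x, hx, hxe, hx0⟩ := D.jne i
  obtain ⟨t, ht⟩ := D.α_gen i x hx hxe
  apply hx0; rw [ht, h, mul_zero]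

/-- the path of length `l` -/
noncomputable def a (i : Fin s) : ℕ → R
  | 0 => D.e i
  | l + 1 => D.α (D.τ^[l] i) * a i l

theorem a_zero (i) : D.a i 0 = D.e i := rfl
theorem a_succ (i l) : D.a i (l+1) = D.α (D.τ^[l] i) * D.a i l := rfl

theorem e_a (i l) : D.e (D.τ^[l] i) * D.a i l = D.a i l := by
  cases l with
  | zero => exact D.idem i
  | succ l => rw [a_succ, Function.iterate_succ_apply', ← mul_assoc, e_α]

theorem a_e (i l) : D.a i l * D.e i = D.a i l := by
  induction l with
  | zero => exact D.idem i
  | succ l ih => rw [a_succ, mul_assoc, ih]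

theorem a_one (i) : D.a i 1 = D.α i := by
  rw [a_succ, a_zero]; exact D.α_e i

theorem a_add (i l m) : D.a (D.τ^[l] i) m * D.a i l = D.a i (l + m) := by
  induction m with
  | zero => rw [a_zero, e_a, add_zero]
  | succ m ih => rw [a_succ, mul_assoc, ih, ← add_assoc, a_succ, ← Function.iterate_add_apply, add_comm m l]

theorem a_mem_pow (i l) : D.a i l ∈ (J) ^ l := by
  induction l with
  | zero => rw [Submodule.pow_zero, Ideal.one_eq_top]; trivial
  | succ l ih => 
    rw [a_succ, Ideal.IsTwoSided.pow_succ]; exact Ideal.mul_mem_mul (D.α_mem _) ih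

theorem a_mem (i l) (hl : 0 < l) : D.a i l ∈ J := by
  obtain ⟨l, rfl⟩ := Nat.exists_eq_succ_of_ne_zero hl.ne'
  rw [a_succ]; exact jac_mul_right _ (D.α_mem _)

theorem a_ev (i) : ∃ l, D.a i l = 0 := by
  obtain ⟨n, hn⟩ := jac_nil (R := R)
  refine ⟨n, ?_⟩
  have := D.a_mem_pow i n
  rwa [hn] at this

open Classical in
/-- the length of the `i`-th projective -/
noncomputable def c (i : Fin s) : ℕ := Nat.find (D.a_ev i)

theorem a_c (i) : D.a i (D.c i) = 0 := by classical exact Nat.find_spec (D.a_ev i)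
theorem a_eq_zero (i l) : D.a i l = 0 ↔ D.c i ≤ l := by
  classical
  constructor
  · intro h; exact Nat.find_min' (D.a_ev i) h
  · intro h
    obtain ⟨m, rfl⟩ := Nat.exists_eq_add_of_le h
    rw [← a_add, a_c, mul_zero]

theorem two_le_c (i) : 2 ≤ D.c i := by
  by_contra h
  have := (D.a_eq_zero i 1).2 (by omega)
  rw [a_one] at this
  exact D.α_ne i this

theorem c_le (i) : D.c i ≤ D.c (D.τ i) + 1 := by
  rw [← a_eq_zero, add_comm, ← a_add, Function.iterate_one, a_c, zero_mul]

theorem left (i) (r : R) (hr : r * D.e i = r) (h0 : r ≠ 0) :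
    ∃ l t, r = t * D.a i l ∧ t * D.e (D.τ^[l] i) = t ∧ ∃ v, v * t = D.e (D.τ^[l] i) := by
  classical
  have hex : ∃ l, ¬ ∃ t, r = t * D.a i l := by
    refine ⟨D.c i, ?_⟩
    rintro ⟨t, ht⟩
    rw [a_c, mul_zero] at ht; exact h0 ht
  have hs := Nat.find_spec hex
  set L := Nat.find hex with hL
  have hL0 : L ≠ 0 := by
    intro h; rw [h] at hs; exact hs ⟨r, hr.symm⟩
  obtain ⟨l, hl⟩ := Nat.exists_eq_succ_of_ne_zero hL0
  obtain ⟨t, ht⟩ := not_not.1 (Nat.find_min hex (m := l) (by omega))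
  have hte : t * D.e (D.τ^[l] i) * D.e (D.τ^[l] i) = t * D.e (D.τ^[l] i) := by rw [mul_assoc, D.idem]
  refine ⟨l, t * D.e (D.τ^[l] i), by rw [mul_assoc, e_a]; exact ht, hte, ?_⟩
  refine ((D.uni _).mem_or hte).resolve_left ?_
  intro hJ
  obtain ⟨u, hu⟩ := D.α_gen _ _ hJ hte
  apply hs
  rw [hl]
  exact ⟨u, by rw [Nat.succ_eq_add_one, a_succ, ← mul_assoc, ← hu, mul_assoc, e_a]; exact ht⟩

theorem left' (i) (r : R) (hr : r * D.e i = r) (h0 : r ≠ 0) :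
    ∃ l, (∃ t, r = t * D.a i l) ∧ ∃ t, D.a i l = t * r := by
  obtain ⟨l, t, h1, h2, v, hv⟩ := D.left i r hr h0
  exact ⟨l, ⟨t, h1⟩, v, by rw [h1, ← mul_assoc, hv, e_a]⟩

theorem corner (i j) (x : R) (h1 : D.e j * x = x) (h2 : x * D.e i = x) (h0 : x ≠ 0) :
    ∃ l u v, D.τ^[l] i = j ∧ x = u * D.a i l ∧ D.a i l = v * x := by
  obtain ⟨l, t, ht, hte, v, hv⟩ := D.left i x h2 h0
  have h3 : D.a i l = v * x := by rw [ht, ← mul_assoc, hv, e_a]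
  refine ⟨l, t, v, ?_, ht, h3⟩
  by_contra hne
  have h4 : D.e j * t ∈ J := D.sep _ _ _ hne (by rw [← mul_assoc, D.idem]) (by rw [mul_assoc, hte])
  have h5 : D.a i l = (v * (D.e j * t)) * D.a i l := by
    calc D.a i l = v * x := h3
      _ = v * (D.e j * (t * D.a i l)) := by rw [← ht, h1]
      _ = _ := by noncomm_ring
  have h6 : D.a i l = 0 := by
    obtain ⟨g, hg, -⟩ := jac_inv (jac_mul_left v h4)
    calc D.a i l = g * (1 - v * (D.e j * t)) * D.a i l := by rw [hg, one_mul]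
      _ = 0 := by rw [mul_assoc, sub_mul, one_mul, ← h5, sub_self, mul_zero]
  rw [h6, mul_zero] at ht
  exact h0 ht

theorem right (j) (r : R) (hr : D.e j * r = r) (h0 : r ≠ 0) :
    ∃ k l, D.τ^[l] k = j ∧ (∃ t, r = D.a k l * t) ∧ ∃ t, D.a k l = r * t := by
  obtain ⟨i, r', t, ht⟩ := D.lemG' j r hr
  set x := r * r' * D.e i with hx
  have hx0 : x ≠ 0 := by rintro h; rw [h, zero_mul] at ht; exact h0 ht
  have hx1 : D.e j * x = x := by rw [hx]; simp only [← mul_assoc, hr]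
  have hx2 : x * D.e i = x := by rw [hx, mul_assoc, D.idem]
  obtain ⟨l, u, v, hl, h1, h2⟩ := D.corner i j x hx1 hx2 hx0
  refine ⟨i, l, hl, ?_⟩
  have ha1 : D.e j * D.a i l = D.a i l := by rw [← hl, e_a]
  -- x and a are right associated
  suffices h : (∃ w, x = D.a i l * w) ∧ ∃ w, D.a i l = x * w by
    obtain ⟨⟨w, hw⟩, ⟨w', hw'⟩⟩ := h
    exact ⟨⟨w * t, by rw [← mul_assoc, ← hw]; exact ht⟩, ⟨r' * D.e i * w', by rw [← mul_assoc, ← mul_assoc, ← hx]; exact hw'⟩⟩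
  -- general: x = u a, a = v x, x = a w implies a in xR
  have key : ∀ x y u v : R, x * D.e i = x → y * D.e i = y → x ≠ 0 → y ≠ 0 → x = u * y → y = v * x → ∀ w, x = y * w → ∃ w, y = x * w := by
    intro x y u v hxe hye hx0 hy0 h1 h2 w hw
    have hw' : x = y * (D.e i * w * D.e i) := by
      calc x = x * D.e i := hxe.symm
        _ = y * D.e i * w * D.e i := by rw [hye, ← hw]
        _ = _ := by noncomm_ring
    have hJ : D.e i * w * D.e i ∉ J := by
      intro hJ
      apply hy0
      refine zero_of_eq_mul (a := v) hJ ?_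
      rw [mul_assoc, ← hw', ← h2]
    obtain ⟨g, -, -, -, hg⟩ := (D.uni i).inv (by simp only [← mul_assoc, D.idem]) (by simp only [mul_assoc, D.idem]) hJ
    exact ⟨g, by rw [hw', mul_assoc, hg, hye]⟩
  have ha0 : D.a i l ≠ 0 := by intro h; rw [h, mul_zero] at h1; exact hx0 h1
  rcases D.rcomp i i j x (D.a i l) hx1 hx2 ha1 (D.a_e i l) with ⟨w, hw⟩ | ⟨w, hw⟩
  · exact ⟨⟨w, hw⟩, key x (D.a i l) u v hx2 (D.a_e i l) hx0 ha0 h1 h2 w hw⟩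
  · exact ⟨key (D.a i l) x v u (D.a_e i l) hx2 ha0 hx0 h2 h1 w hw, ⟨w, hw⟩⟩

theorem τ_inj : Function.Injective D.τ := by
  have key : ∀ i k, i ≠ k → ∀ v, D.α i = D.α k * v → False := by
    intro i k hik v hv
    have hv' : D.α i = D.α k * (D.e k * v * D.e i) := by
      calc D.α i = D.α i * D.e i := (D.α_e i).symm
        _ = D.α k * D.e k * v * D.e i := by rw [D.α_e k, ← hv]
        _ = _ := by noncomm_ring
    have hJ : D.e k * v * D.e i ∈ J := D.sep i k _ hik (by simp only [← mul_assoc, D.idem]) (by simp only [mul_assoc, D.idem])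
    obtain ⟨t, ht⟩ := D.α_gen i _ hJ (by simp only [mul_assoc, D.idem])
    rw [ht, ← mul_assoc] at hv'
    obtain ⟨g, hg, -⟩ := jac_inv (jac_mul_right t (D.α_mem k))
    apply D.α_ne i
    calc D.α i = g * (1 - D.α k * t) * D.α i := by rw [hg, one_mul]
      _ = 0 := by rw [mul_assoc, sub_mul, one_mul, ← hv', sub_self, mul_zero]
  intro i k h
  by_contra hik
  rcases D.rcomp i k (D.τ i) (D.α i) (D.α k) (D.e_α i) (D.α_e i) (by rw [h, e_α]) (D.α_e k) with ⟨t, ht⟩ | ⟨t, ht⟩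
  · exact key i k hik t ht
  · exact key k i (Ne.symm hik) t ht

noncomputable def perm : Equiv.Perm (Fin s) := Equiv.ofBijective D.τ (Finite.injective_iff_bijective.1 D.τ_inj)

theorem perm_pow (l : ℕ) (i) : (D.perm ^ (l : ℤ)) i = D.τ^[l] i := by
  rw [zpow_natCast, ← Equiv.Perm.iterate_eq_pow]; rfl

/-- chain of submodules `R a(i,l)` -/
theorem hasLength (i) : HasLength R (Ideal.span {D.e i} : Ideal R) (D.c i) := by
  let P : Ideal R := Ideal.span {D.e i}
  have hmem : ∀ l, D.a i l ∈ Ideal.span {D.e i} := fun l => (mem_span_idem (D.idem i) _).2 (D.a_e i l)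
  let ch : ℕ → Submodule R P := fun l => Submodule.span R {⟨D.a i l, hmem l⟩}
  have hch : ∀ l (z : P), z ∈ ch l ↔ ∃ t, z.1 = t * D.a i l := by
    intro l z
    rw [Submodule.mem_span_singleton]
    constructor
    · rintro ⟨t, rfl⟩; exact ⟨t, rfl⟩
    · rintro ⟨t, ht⟩; exact ⟨t, Subtype.ext ht.symm⟩
  refine ⟨fun k => ch (D.c i - k), ?_, ?_, ?_⟩
  · rw [eq_bot_iff]
    intro z hz
    obtain ⟨t, ht⟩ := (hch _ z).1 hz
    rw [Submodule.mem_bot]; ext1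
    simpa [D.a_c] using ht
  · rw [eq_top_iff]
    rintro z -
    rw [hch]
    refine ⟨z.1, ?_⟩
    rw [Fin.val_last, Nat.sub_self, a_zero]
    exact ((mem_span_idem (D.idem i) _).1 z.2).symm
  · intro k
    have hk := k.2
    simp only [Fin.val_castSucc, Fin.val_succ]
    obtain ⟨l, hl⟩ : ∃ l, D.c i - (k + 1) = l := ⟨_, rfl⟩
    rw [hl, show D.c i - k = l + 1 by omega]
    have hne : D.a i l ≠ 0 := by rw [Ne, a_eq_zero]; omega
    constructor
    · refine lt_of_le_of_ne ?_ ?_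
      · intro z hz
        rw [hch] at hz ⊢
        obtain ⟨t, ht⟩ := hz
        exact ⟨t * D.α (D.τ^[l] i), by rw [ht, a_succ, mul_assoc]⟩
      · intro h
        have : (⟨D.a i l, hmem l⟩ : P) ∈ ch (l+1) := by rw [h, hch]; exact ⟨1, (one_mul _).symm⟩
        obtain ⟨t, ht⟩ := (hch _ _).1 this
        simp only [a_succ] at ht
        obtain ⟨g, hg, -⟩ := jac_inv (jac_mul_left t (D.α_mem (D.τ^[l] i)))
        apply hne
        calc D.a i l = g * (1 - t * D.α (D.τ^[l] i)) * D.a i l := by rw [hg, one_mul]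
          _ = 0 := by rw [mul_assoc, sub_mul, one_mul, mul_assoc t, ← ht, sub_self, mul_zero]
    · intro N h1 h2
      obtain ⟨z, hzN, hz⟩ := SetLike.exists_of_lt h1
      have hz0 : z.1 ≠ 0 := by
        intro h; apply hz; rw [hch]; exact ⟨0, by simp [h]⟩
      obtain ⟨m, ⟨t, ht⟩, ⟨t', ht'⟩⟩ := D.left' i z.1 ((mem_span_idem (D.idem i) _).1 z.2) hz0
      have hml : m ≤ l := by
        by_contra hc
        obtain ⟨d, rfl⟩ : ∃ d, m = l + 1 + d := ⟨m - (l+1), by omega⟩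
        apply hz; rw [hch]
        exact ⟨t * D.a (D.τ^[l+1] i) d, by rw [ht, mul_assoc, a_add]⟩
      obtain ⟨d, rfl⟩ := Nat.exists_eq_add_of_le hml
      apply h2.not_ge
      intro y hy
      obtain ⟨u, hu⟩ := (hch _ y).1 hy
      have : y = (u * D.a (D.τ^[m] i) d * t') • z := by
        ext1
        simp only [SetLike.val_smul, smul_eq_mul]
        rw [mul_assoc, ← ht', mul_assoc, a_add, hu]
      rw [this]; exact N.smul_mem _ hzN

theorem lt_c (hp : MinProjLengthGT R s) (i) : s < D.c i :=
  hp _ (projective_span_idem (D.idem i)) (D.indec i) _ (D.hasLength i)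

theorem exists_period (b : Fin s) : ∃ n : ℕ, 0 < n ∧ n ≤ s ∧ (D.perm ^ (n : ℤ)) b = b := by
  have := Fintype.exists_ne_map_eq_of_card_lt (fun k : Fin (s+1) => (D.perm ^ (k : ℕ)) b) (by simp)
  obtain ⟨x, y, hne, h⟩ := this
  have key : ∀ x y : Fin (s+1), x < y → (D.perm ^ (x : ℕ)) b = (D.perm ^ (y : ℕ)) b → ∃ n : ℕ, 0 < n ∧ n ≤ s ∧ (D.perm ^ (n : ℤ)) b = b := by
    intro x y hxy h
    have hx := x.2; have hy := y.2
    refine ⟨y - x, by have := hxy; omega, by omega, ?_⟩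
    have hxy' : (x : ℕ) ≤ y := le_of_lt hxy
    apply (D.perm ^ (x : ℕ)).injective
    rw [zpow_natCast, ← Equiv.Perm.mul_apply, ← pow_add, Nat.add_sub_cancel' hxy', h]
  rcases lt_or_gt_of_ne hne with h1 | h1
  · exact key x y h1 h
  · exact key y x h1 h.symm

/-- position function -/
noncomputable def F (b : Fin s) (x : ℤ) : ℤ := x + D.c ((D.perm ^ x) b)

theorem perm_succ (b : Fin s) (x : ℤ) : (D.perm ^ (x + 1)) b = D.τ ((D.perm ^ x) b) := by
  rw [add_comm, zpow_add, zpow_one]; rfl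

theorem perm_add (b : Fin s) (x : ℤ) (l : ℕ) : (D.perm ^ (x + l)) b = D.τ^[l] ((D.perm ^ x) b) := by
  rw [add_comm, zpow_add, Equiv.Perm.mul_apply, perm_pow]

theorem F_mono (b) : Monotone (D.F b) := by
  apply monotone_int_of_le_succ
  intro x
  unfold F
  rw [perm_succ]
  have := D.c_le ((D.perm ^ x) b)
  omega

theorem F_gc (b : Fin s) (y : ℤ) : ∃ u : ℤ, ∀ w, D.F b w ≤ y ↔ w ≤ u := by
  have h1 : ∀ x, x ≤ D.F b x := fun x => by unfold F; omega
  have h2 : ∀ x, D.F b x ≤ x + ∑ i, D.c i := by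
    intro x; unfold F
    have := Finset.single_le_sum (f := D.c) (fun _ _ => Nat.zero_le _) (Finset.mem_univ ((D.perm ^ x) b))
    have : (D.c ((D.perm ^ x) b) : ℤ) ≤ ((∑ i, D.c i : ℕ) : ℤ) := by exact_mod_cast this
    push_cast at this ⊢; omega
  obtain ⟨u, hu, hmax⟩ := Int.exists_greatest_of_bdd (P := fun w => D.F b w ≤ y)
    ⟨y, fun z hz => (h1 z).trans hz⟩ ⟨y - ∑ i, D.c i, (h2 _).trans (by omega)⟩
  exact ⟨u, fun w => ⟨hmax w, fun h => (D.F_mono b h).trans hu⟩⟩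

noncomputable def Z (hp : MinProjLengthGT R s) : ZSerial R (Fin s) where
  e b x := D.e ((D.perm ^ x) b)
  p b x y := D.a ((D.perm ^ x) b) (y - x).toNat
  f := D.F
  h b y := (D.F_gc b y).choose
  N b := (D.exists_period b).choose
  p_self b x := by rw [sub_self]; rfl
  p_comp b x y z hxy hyz := by
    obtain ⟨l, rfl⟩ := Int.exists_add_of_le hxy
    obtain ⟨m, rfl⟩ := Int.exists_add_of_le hyz
    rw [perm_add, show (x + l + m - (x + l)).toNat = m by omega, show (x + l - x).toNat = l by omega,
      show (x + l + m - x).toNat = l + m by omega, a_add]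
  p_zero b x y hxy := by
    rw [a_eq_zero, F]; omega
  left b x r hr h0 := by
    obtain ⟨l, h1, h2⟩ := D.left' _ r hr h0
    refine ⟨x + l, by omega, ?_⟩
    rw [show (x + l - x).toNat = l by omega]
    exact ⟨h1, h2⟩
  right b y r hr h0 := by
    obtain ⟨k, l, hl, h1, h2⟩ := D.right _ r hr h0
    refine ⟨y - l, by omega, ?_⟩
    have hk : (D.perm ^ (y - l)) b = k := by
      apply (D.τ_inj.iterate l)
      rw [← perm_add, sub_add_cancel, hl]
    rw [show (y - (y - l)).toNat = l by omega, hk]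
    exact ⟨h1, h2⟩
  full := by
    refine AddSubgroup.closure_mono ?_ D.full
    rintro _ ⟨r, i, t, rfl⟩
    exact ⟨r, i, 0, t, by simp⟩
  nil b x y hxy r t := jac_isNilpotent (jac_mul_right _ (jac_mul_left _ (D.a_mem _ _ (by omega))))
  mono := D.F_mono
  gc b w y := (D.F_gc b y).choose_spec w
  Npos b := by have := (D.exists_period b).choose_spec.1; omega
  shift b x := by
    have := (D.exists_period b).choose_spec.2.2
    unfold F
    rw [zpow_add, Equiv.Perm.mul_apply, this]; ring
  big b x := by
    have := (D.exists_period b).choose_spec.2.1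
    have := D.lt_c hp ((D.perm ^ x) b)
    unfold F; omega

end Bas
end Paths

section Translate
variable {R : Type u} [Ring R] [IsArtinianRing R]
local notation "J" => Ring.jacobson R

namespace Bas
variable {s : ℕ} (D : Bas R s)

theorem type_unique {i k : Fin s} {V : Type u} [AddCommGroup V] [Module R V]
    (h1 : HasType (D.e i) V) (h2 : HasType (D.e k) V) : i = k := by
  by_contra hik
  obtain ⟨hV, v, hv, hev⟩ := h1
  obtain ⟨-, w, hw, hew⟩ := h2
  obtain ⟨r, hr⟩ := IsSimpleModule.toSpanSingleton_surjective R hv w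
  rw [LinearMap.toSpanSingleton_apply] at hr
  apply hw
  have hJ : D.e k * r * D.e i ∈ J := D.sep i k _ hik (by simp only [← mul_assoc, D.idem]) (by simp only [mul_assoc, D.idem])
  have : w = (D.e k * r * D.e i) • v := by rw [mul_smul, mul_smul, hev, hr, hew]
  rw [this]; exact jac_kill hJ v

/-- `M` is generated by `m`, uniserial of length `n` with top of type `k` -/
structure Gen (k : Fin s) (n : ℕ) {M : Type u} [AddCommGroup M] [Module R M] (m : M) : Prop where
  gen : ∀ z : M, ∃ r : R, z = r • m
  em : D.e k • m = m
  kill : D.a k n • m = 0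
  ne : ∀ l < n, D.a k l • m ≠ 0
  pos : 0 < n

variable {D}

namespace Gen
variable {k : Fin s} {n : ℕ} {M : Type u} [AddCommGroup M] [Module R M] {m : M}

theorem elt (h : D.Gen k n m) (z : M) (hz : z ≠ 0) :
    ∃ l < n, (∃ u : R, z = u • D.a k l • m) ∧ ∃ v : R, D.a k l • m = v • z := by
  obtain ⟨r, rfl⟩ := h.gen z
  have hr : (r * D.e k) • m = r • m := by rw [mul_smul, h.em]
  have h0 : r * D.e k ≠ 0 := by intro h0; rw [h0, zero_smul] at hr; exact hz hr.symm
  obtain ⟨l, ⟨u, hu⟩, ⟨v, hv⟩⟩ := D.left' k (r * D.e k) (by rw [mul_assoc, D.idem]) h0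
  refine ⟨l, ?_, ⟨u, by rw [← mul_smul, ← hu, hr]⟩, ⟨v, by rw [hv, mul_smul, hr]⟩⟩
  by_contra hl
  obtain ⟨d, rfl⟩ := Nat.exists_eq_add_of_le (not_lt.1 hl)
  apply hz
  rw [← hr, hu, ← a_add, mul_smul, mul_smul, h.kill, smul_zero, smul_zero]

theorem last_mem (h : D.Gen k n m) (N : Submodule R M) (hN : N ≠ ⊥) : D.a k (n-1) • m ∈ N := by
  obtain ⟨z, hz, hz0⟩ := N.ne_bot_iff.1 hN
  obtain ⟨l, hl, -, v, hv⟩ := h.elt z hz0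
  obtain ⟨d, hd⟩ : ∃ d, n - 1 = l + d := ⟨n - 1 - l, by omega⟩
  rw [hd, ← a_add, mul_smul, hv]
  exact N.smul_mem _ (N.smul_mem _ hz)

theorem atom (h : D.Gen k n m) : IsAtom (Submodule.span R {D.a k (n-1) • m}) := by
  have := h.pos
  have hne := h.ne (n-1) (by omega)
  refine ⟨by rwa [Ne, Submodule.span_singleton_eq_bot], ?_⟩
  intro N hN
  by_contra hc
  exact hN.not_ge (by rw [Submodule.span_singleton_le_iff_mem]; exact h.last_mem N hc)

theorem socle (h : D.Gen k n m) : modSocle R M = Submodule.span R {D.a k (n-1) • m} := by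
  apply le_antisymm
  · apply sSup_le
    intro N hN
    have := h.last_mem N hN.1
    have h2 : Submodule.span R {D.a k (n-1) • m} ≤ N := by rwa [Submodule.span_singleton_le_iff_mem]
    rcases hN.le_iff.1 h2 with h3 | h3
    · exact absurd h3 h.atom.1
    · rw [h3]
  · exact le_sSup h.atom

theorem socle_type (h : D.Gen k n m) : HasType (D.e (D.τ^[n-1] k)) (Submodule.span R {D.a k (n-1) • m}) := by
  have := h.pos
  refine ⟨isSimpleModule_iff_isAtom.2 h.atom, ⟨_, Submodule.mem_span_singleton_self _⟩, ?_, ?_⟩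
  · intro h0; exact h.ne (n-1) (by omega) (congrArg Subtype.val h0)
  · ext1; simp only [SetLike.val_smul]; rw [← mul_smul, e_a]

theorem isSocleOf (h : D.Gen k n m) {T : Type u} [AddCommGroup T] [Module R T] (hT : HasType (D.e (D.τ^[n-1] k)) T) :
    IsSocleOf R T M := by
  obtain ⟨φ⟩ := hT.equiv (D.uni _) h.socle_type
  refine ⟨(Submodule.subtype _).comp φ.toLinearMap, ?_, ?_⟩
  · exact (Submodule.injective_subtype _).comp φ.injective
  · rw [LinearMap.range_comp, LinearEquiv.range, Submodule.map_top, Submodule.range_subtype, h.socle]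

theorem hasType (h : D.Gen k 1 m) : HasType (D.e k) M := by
  have hs : (Submodule.span R {D.a k (1-1) • m}) = ⊤ := by
    rw [eq_top_iff]
    rintro z -
    obtain ⟨r, rfl⟩ := h.gen z
    rw [Submodule.mem_span_singleton]
    exact ⟨r, by rw [Nat.sub_self, a_zero, h.em]⟩
  have h2 := h.socle_type
  exact h2.congr ((LinearEquiv.ofEq _ _ hs).trans Submodule.topEquiv)

theorem of_type (h : D.Gen k n m) {T : Type u} [AddCommGroup T] [Module R T] (hT : IsSimpleModule R T)
    (hS : IsSocleOf R T M) : HasType (D.e (D.τ^[n-1] k)) T := by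
  obtain ⟨ι, hι, hr⟩ := hS
  rw [h.socle] at hr
  exact h.socle_type.congr ((LinearEquiv.ofEq _ _ hr.symm).trans (LinearEquiv.ofInjective ι hι).symm)

theorem congr (h : D.Gen k n m) {M' : Type u} [AddCommGroup M'] [Module R M'] (φ : M ≃ₗ[R] M') :
    D.Gen k n (φ m) where
  gen z := by
    obtain ⟨r, hr⟩ := h.gen (φ.symm z)
    exact ⟨r, by rw [← map_smul, ← hr, φ.apply_symm_apply]⟩
  em := by rw [← map_smul, h.em]
  kill := by rw [← map_smul, h.kill, map_zero]
  ne l hl := by rw [← map_smul, Ne, LinearEquiv.map_eq_zero_iff]; exact h.ne l hl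
  pos := h.pos

end Gen

variable (D)

/-- the indecomposable projectives -/
abbrev P (i : Fin s) : Ideal R := Ideal.span {D.e i}
/-- top generator -/
def g (i : Fin s) : D.P i := ⟨D.e i, Ideal.mem_span_singleton_self _⟩

theorem genP (i : Fin s) : D.Gen i (D.c i) (D.g i) where
  gen z := ⟨z.1, Subtype.ext (by
    simp only [g, SetLike.val_smul, smul_eq_mul]
    exact ((mem_span_idem (D.idem i) _).1 z.2).symm)⟩
  em := Subtype.ext (by simp only [g, SetLike.val_smul, smul_eq_mul]; exact D.idem i)
  kill := Subtype.ext (by simp [g, a_c])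
  ne l hl h := by
    have := congrArg Subtype.val h
    simp only [g, SetLike.val_smul, smul_eq_mul] at this
    rw [a_e] at this
    have := (D.a_eq_zero i l).1 this
    omega
  pos := by have := D.two_le_c i; omega

theorem a_not (i l r) (h : D.a i l = r * D.a i (l+1)) : D.a i l = 0 := by
  rw [a_succ] at h
  obtain ⟨g, hg, -⟩ := jac_inv (jac_mul_left r (D.α_mem (D.τ^[l] i)))
  calc D.a i l = g * (1 - r * D.α (D.τ^[l] i)) * D.a i l := by rw [hg, one_mul]
    _ = 0 := by rw [mul_assoc, sub_mul, one_mul, mul_assoc r, ← h, sub_self, mul_zero]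

/-- the uniserial quotient of length `n` -/
abbrev Q (i : Fin s) (n : ℕ) : Type u := D.P i ⧸ Submodule.span R {D.a i n • D.g i}

theorem genQ (i : Fin s) (n : ℕ) (h0 : 0 < n) (hn : n ≤ D.c i) :
    D.Gen i n (M := D.Q i n) (Submodule.mkQ _ (D.g i)) where
  gen z := by
    obtain ⟨y, rfl⟩ := Submodule.mkQ_surjective _ z
    obtain ⟨r, rfl⟩ := (D.genP i).gen y
    exact ⟨r, map_smul _ _ _⟩
  em := by rw [← map_smul, (D.genP i).em]
  kill := by
    rw [← map_smul, Submodule.mkQ_apply, Submodule.Quotient.mk_eq_zero]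
    exact Submodule.mem_span_singleton_self _
  ne l hl h := by
    rw [← map_smul, Submodule.mkQ_apply, Submodule.Quotient.mk_eq_zero, Submodule.mem_span_singleton] at h
    obtain ⟨r, hr⟩ := h
    have := congrArg Subtype.val hr
    simp only [g, SetLike.val_smul, smul_eq_mul] at this
    rw [a_e, a_e] at this
    obtain ⟨d, rfl⟩ : ∃ d, n = l + 1 + d := ⟨n - l - 1, by omega⟩
    rw [← a_add, ← mul_assoc] at this
    have := (D.a_eq_zero i l).1 (D.a_not i l _ this.symm)
    omega
  pos := h0

/-- the standard simple module of type `i` -/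
def St (i : Fin s) : ModuleCat.{u} R := ModuleCat.of R (D.Q i 1)

theorem St_type (i : Fin s) : HasType (D.e i) (D.St i) :=
  (D.genQ i 1 one_pos (by have := D.two_le_c i; omega)).hasType

/-- radical elements lie in the module radical -/
theorem smul_mem_rad {M : Type u} [AddCommGroup M] [Module R M] {x : R} (hx : x ∈ J) (m : M) :
    x • m ∈ modRadical R M := by
  rw [modRadical, Submodule.mem_sInf]
  intro N hN
  have : IsSimpleModule R (M ⧸ N) := isSimpleModule_iff_isCoatom.2 hN
  have h := jac_kill hx (N.mkQ m)
  rwa [← map_smul, Submodule.mkQ_apply, Submodule.Quotient.mk_eq_zero] at h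

theorem ker_eq {i : Fin s} {n : ℕ} {M : Type u} [AddCommGroup M] [Module R M] {m : M} (hm : D.Gen i n m)
    {S : Type u} [AddCommGroup S] [Module R S] (hS : IsSimpleModule R S)
    (q : M →ₗ[R] S) (hq : q m ≠ 0) (z : M) : z ∈ LinearMap.ker q ↔ ∃ r : R, z = r • D.α i • m := by
  constructor
  · intro hz
    obtain ⟨r, rfl⟩ := hm.gen z
    rcases (D.uni i).mem_or (z := r * D.e i) (by rw [mul_assoc, D.idem]) with h | ⟨v, hv⟩
    · obtain ⟨t, ht⟩ := D.α_gen i _ h (by rw [mul_assoc, D.idem])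
      exact ⟨t, by rw [← mul_smul, ← ht, mul_smul, hm.em]⟩
    · exfalso; apply hq
      rw [← hm.em, ← hv, mul_smul, mul_smul, hm.em, map_smul, LinearMap.mem_ker.1 hz, smul_zero]
  · rintro ⟨r, rfl⟩
    rw [LinearMap.mem_ker, map_smul, map_smul, jac_kill (D.α_mem i), smul_zero]

theorem exists_lift {i : Fin s} {n : ℕ} {M : Type u} [AddCommGroup M] [Module R M] {m : M} (hm : D.Gen i n m)
    {S : Type u} [AddCommGroup S] [Module R S] (hS : HasType (D.e i) S) :
    ∃ q : M →ₗ[R] S, Function.Surjective q ∧ q m ≠ 0 ∧ LinearMap.ker q = modRadical R M := by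
  have hSs := hS.1
  obtain ⟨φ⟩ := hS.equiv (D.uni i) (D.St_type i)
  obtain ⟨-, v, hv, hev⟩ := hS
  have hwd : ∀ r r' : R, r • m = r' • m → r • v = r' • v := by
    intro r r' h
    rw [← sub_eq_zero, ← sub_smul] at h ⊢
    rcases (D.uni i).mem_or (z := (r - r') * D.e i) (by rw [mul_assoc, D.idem]) with h1 | ⟨w, hw⟩
    · rw [← hev, ← mul_smul]; exact jac_kill h1 v
    · exfalso
      apply hm.ne 0 hm.pos
      rw [a_zero, ← hw, mul_smul, mul_smul, hm.em, h, smul_zero]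
  choose ρ hρ using hm.gen
  let q : M →ₗ[R] S :=
    { toFun := fun z => ρ z • v
      map_add' := fun x y => by
        rw [← add_smul]; apply hwd; rw [add_smul, ← hρ, ← hρ, ← hρ]
      map_smul' := fun r x => by
        rw [RingHom.id_apply, ← mul_smul]; apply hwd; rw [mul_smul, ← hρ, ← hρ] }
  have hqm : ∀ r : R, q (r • m) = r • v := fun r => hwd _ _ (hρ _).symm
  have hq1 : q m ≠ 0 := by have := hqm 1; rw [one_smul, one_smul] at this; rwa [this]
  have hsurj : Function.Surjective q := by
    intro w
    obtain ⟨r, hr⟩ := IsSimpleModule.toSpanSingleton_surjective R hv w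
    exact ⟨r • m, by rw [hqm]; exact hr⟩
  refine ⟨q, hsurj, hq1, ?_⟩
  apply le_antisymm
  · intro z hz
    obtain ⟨r, rfl⟩ := (D.ker_eq hm hSs q hq1 z).1 hz
    rw [← mul_smul]; exact smul_mem_rad (jac_mul_left _ (D.α_mem i)) m
  · apply sInf_le
    exact isSimpleModule_iff_isCoatom.1 ((LinearEquiv.isSimpleModule_iff (q.quotKerEquivOfSurjective hsurj)).2 hSs)

theorem exists_cover {i : Fin s} {S : Type u} [AddCommGroup S] [Module R S] (hS : HasType (D.e i) S) :
    ∃ q : D.P i →ₗ[R] S, IsProjCover q := by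
  obtain ⟨q, h1, -, h2⟩ := D.exists_lift (D.genP i) hS
  exact ⟨q, projective_span_idem (D.idem i), h1, h2.le⟩

theorem rad_proj {M : Type u} [AddCommGroup M] [Module R M] (hM : Module.Projective R M) :
    modRadical R M ≤ (J) • (⊤ : Submodule R M) := by
  intro x hx
  obtain ⟨σ, hσ⟩ := hM.out
  have h1 : ∀ y, σ x y ∈ J := by
    intro y
    have h2 := Module.le_comap_jacobson ((Finsupp.lapply y).comp σ) (x := x) hx
    exact h2
  have h3 := hσ x
  rw [Finsupp.linearCombination_apply] at h3
  rw [← h3]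
  apply Submodule.sum_mem
  intro y _
  exact Submodule.smul_mem_smul (h1 y) trivial

theorem nak {M : Type u} [AddCommGroup M] [Module R M] (N : Submodule R M)
    (h : ⊤ ≤ N ⊔ (J) • (⊤ : Submodule R M)) : N = ⊤ := by
  have key : ∀ n : ℕ, ⊤ ≤ N ⊔ ((J) ^ n) • (⊤ : Submodule R M) := by
    intro n
    induction n with
    | zero => rw [Submodule.pow_zero, Ideal.one_eq_top, Submodule.top_smul]; exact le_sup_right
    | succ n ih =>
      refine ih.trans (sup_le le_sup_left ?_)
      calc ((J) ^ n) • (⊤ : Submodule R M) ≤ ((J) ^ n) • (N ⊔ (J) • (⊤ : Submodule R M)) := Submodule.smul_mono le_rfl h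
        _ = ((J) ^ n) • N ⊔ ((J) ^ n) • (J) • (⊤ : Submodule R M) := Submodule.smul_sup _ _ _
        _ ≤ _ := sup_le (Submodule.smul_le_right.trans le_sup_left) (by
          rw [← Submodule.mul_smul, ← Submodule.pow_succ]; exact le_sup_right)
  obtain ⟨n, hn⟩ := jac_nil (R := R)
  have := key n
  rw [hn, Submodule.bot_smul, sup_bot_eq] at this
  exact top_le_iff.1 this

theorem cover_equiv {i : Fin s} {S : Type u} [AddCommGroup S] [Module R S] (hS : HasType (D.e i) S)
    {M : Type u} [AddCommGroup M] [Module R M] (p : M →ₗ[R] S) (hp : IsProjCover p) :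
    ∃ φ : D.P i ≃ₗ[R] M, p (φ (D.g i)) ≠ 0 := by
  obtain ⟨hSs, v, hv, hev⟩ := hS
  obtain ⟨m0, hm0⟩ := hp.surjective v
  set m := D.e i • m0 with hmdef
  have hpm : p m = v := by rw [map_smul, hm0, hev]
  have hem : D.e i • m = m := by rw [hmdef, ← mul_smul, D.idem]
  let f : D.P i →ₗ[R] M := (LinearMap.toSpanSingleton R M m).comp (D.P i).subtype
  have hf : ∀ x, f x = x.1 • m := fun x => rfl
  have htop : LinearMap.range f = ⊤ := by
    apply nak
    intro x _
    obtain ⟨r, hr⟩ := IsSimpleModule.toSpanSingleton_surjective R hv (p x)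
    rw [LinearMap.toSpanSingleton_apply] at hr
    have h1 : r • m ∈ LinearMap.range f := ⟨r • D.g i, by rw [hf]; simp only [g, SetLike.val_smul, smul_eq_mul]; rw [mul_smul, hem]⟩
    have h2 : x - r • m ∈ LinearMap.ker p := by
      rw [LinearMap.mem_ker, map_sub, map_smul, hpm, hr, sub_self]
    rw [← add_sub_cancel (r • m) x]
    exact Submodule.add_mem_sup h1 (rad_proj hp.projective (hp.superfluous h2))
  have hproj := hp.projective
  obtain ⟨σ, hσ⟩ := Module.projective_lifting_property f LinearMap.id (LinearMap.range_eq_top.1 htop)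
  have hσ' : ∀ x, (σ x).1 • m = x := fun x => by
    have := LinearMap.congr_fun hσ x
    exact this
  have hw1 : D.e i * (σ m).1 = (σ m).1 := by
    have : D.e i • σ m = σ m := by rw [← map_smul, hem]
    exact congrArg Subtype.val this
  have hw2 : (σ m).1 * D.e i = (σ m).1 := (mem_span_idem (D.idem i) _).1 (σ m).2
  have hwJ : (σ m).1 ∉ J := by
    intro hJ
    apply hv
    rw [← hpm, ← hσ' m, map_smul, jac_kill hJ]
  obtain ⟨w, -, -, -, hw⟩ := (D.uni i).inv hw1 hw2 hwJ
  have hinj : Function.Injective f := by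
    rw [← LinearMap.ker_eq_bot, eq_bot_iff]
    intro x hx
    rw [LinearMap.mem_ker, hf] at hx
    have h3 : x.1 * (σ m).1 = 0 := by
      have : x.1 • σ m = 0 := by rw [← map_smul, hx, map_zero]
      exact congrArg Subtype.val this
    rw [Submodule.mem_bot]; ext1
    calc x.1 = x.1 * D.e i := ((mem_span_idem (D.idem i) _).1 x.2).symm
      _ = 0 := by rw [← hw, ← mul_assoc, h3, zero_mul]
  refine ⟨LinearEquiv.ofBijective f ⟨hinj, LinearMap.range_eq_top.1 htop⟩, ?_⟩
  have : f (D.g i) = m := hem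
  change p (f (D.g i)) ≠ 0
  rw [this, hpm]; exact hv

/-- black index -/
def blk (i : Fin s) : Prop := D.c i ≤ D.c (D.τ i)
/-- the map `γ` on indices -/
noncomputable def γ (i : Fin s) : Fin s := D.τ^[D.c i] i

theorem proj_iff (i : Fin s) : Module.Projective R (Submodule.span R {D.α i • D.g i}) ↔ ¬ D.blk i := by
  set K := Submodule.span R {D.α i • D.g i} with hK
  let m : K := ⟨D.α i • D.g i, Submodule.mem_span_singleton_self _⟩
  have hc := D.two_le_c i
  have hem : D.e (D.τ i) • m = m := by
    ext1; simp only [m, SetLike.val_smul]; rw [← mul_smul, e_α]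
  have hal : ∀ l, D.a (D.τ i) l • m = 0 ↔ D.c i ≤ l + 1 := by
    intro l
    rw [← a_eq_zero, ← Subtype.coe_inj, ← Subtype.coe_inj]
    simp only [m, g, SetLike.val_smul, smul_eq_mul, ZeroMemClass.coe_zero]
    rw [α_e, ← D.a_one i, add_comm, ← a_add, Function.iterate_one]
  let f : D.P (D.τ i) →ₗ[R] K := (LinearMap.toSpanSingleton R K m).comp (D.P (D.τ i)).subtype
  have hf : ∀ x, f x = x.1 • m := fun x => rfl
  have hsurj : Function.Surjective f := by
    rintro ⟨z, hz⟩
    obtain ⟨r, rfl⟩ := Submodule.mem_span_singleton.1 hz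
    refine ⟨r • D.g _, ?_⟩
    rw [map_smul, hf]
    simp only [g]
    rw [hem]; rfl
  constructor
  · intro hproj hb
    obtain ⟨σ, hσ⟩ := Module.projective_lifting_property f LinearMap.id hsurj
    have hσ' : ∀ x, (σ x).1 • m = x := fun x => LinearMap.congr_fun hσ x
    have hw1 : D.e (D.τ i) * (σ m).1 = (σ m).1 := by
      have : D.e (D.τ i) • σ m = σ m := by rw [← map_smul, hem]
      exact congrArg Subtype.val this
    have hw2 : (σ m).1 * D.e (D.τ i) = (σ m).1 := (mem_span_idem (D.idem _) _).1 (σ m).2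
    have hwJ : (σ m).1 ∉ J := by
      intro hJ
      have h1 := hσ' m
      obtain ⟨g', hg, -⟩ := jac_inv hJ
      have : m = 0 := by
        calc m = (g' * (1 - (σ m).1)) • m := by rw [hg, one_smul]
          _ = 0 := by rw [mul_smul, sub_smul, h1, one_smul, sub_self, smul_zero]
      have h2 := (hal 0).1 (by rw [this, smul_zero])
      omega
    obtain ⟨w, -, -, -, hw⟩ := (D.uni _).inv hw1 hw2 hwJ
    have h1 : D.a (D.τ i) (D.c i - 1) • m = 0 := (hal _).2 (by omega)
    have h2 : D.a (D.τ i) (D.c i - 1) * (σ m).1 = 0 := by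
      have : D.a (D.τ i) (D.c i - 1) • σ m = 0 := by rw [← map_smul, h1, map_zero]
      exact congrArg Subtype.val this
    have h3 : D.a (D.τ i) (D.c i - 1) = 0 := by
      rw [← a_e, ← hw, ← mul_assoc, h2, zero_mul]
    have h4 := (D.a_eq_zero _ _).1 h3
    unfold blk at hb
    omega
  · intro hb
    unfold blk at hb
    have hinj : Function.Injective f := by
      rw [← LinearMap.ker_eq_bot, eq_bot_iff]
      intro x hx
      rw [LinearMap.mem_ker, hf] at hx
      by_contra hx0
      have hx0' : x.1 ≠ 0 := fun h => hx0 (by rw [Submodule.mem_bot]; exact Subtype.ext h)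
      obtain ⟨l, ⟨u, hu⟩, ⟨v, hv⟩⟩ := D.left' _ x.1 ((mem_span_idem (D.idem _) _).1 x.2) hx0'
      have h1 := (hal l).1 (by rw [hv, mul_smul, hx, smul_zero])
      apply hx0'
      rw [hu, (D.a_eq_zero _ _).2 (by omega), mul_zero]
    have := projective_span_idem (D.idem (D.τ i))
    exact Module.Projective.of_equiv (LinearEquiv.ofBijective f ⟨hinj, hsurj⟩)

theorem black_iff {i : Fin s} {S : Type u} [AddCommGroup S] [Module R S] (hS : HasType (D.e i) S) :
    IsBlackSimple R S ↔ D.blk i := by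
  have key : ∀ (M : Type u) [AddCommGroup M] [Module R M] (p : M →ₗ[R] S), IsProjCover p →
      (Module.Projective R (LinearMap.ker p) ↔ ¬ D.blk i) := by
    intro M _ _ p hp
    obtain ⟨φ, hφ⟩ := D.cover_equiv hS p hp
    rw [← D.proj_iff i]
    have hk : LinearMap.ker p = (Submodule.span R {D.α i • D.g i}).map φ.toLinearMap := by
      ext z
      rw [D.ker_eq ((D.genP i).congr φ) hS.1 p hφ, Submodule.map_span, Set.image_singleton, Submodule.mem_span_singleton]
      simp only [LinearEquiv.coe_coe, map_smul]
      exact ⟨fun ⟨r, h⟩ => ⟨r, h.symm⟩, fun ⟨r, h⟩ => ⟨r, h.symm⟩⟩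
    let ψ := (LinearEquiv.submoduleMap φ (Submodule.span R {D.α i • D.g i})).trans (LinearEquiv.ofEq _ _ hk.symm)
    exact ⟨fun h => Module.Projective.of_equiv ψ.symm, fun h => Module.Projective.of_equiv ψ⟩
  constructor
  · rintro ⟨-, h⟩
    obtain ⟨q, hq⟩ := D.exists_cover hS
    have h1 := h (ModuleCat.of R (D.P i)) q hq
    by_contra hc
    exact h1 ((key _ q hq).2 hc)
  · intro h
    exact ⟨hS.1, fun M p hp hpr => (key M p hp).1 hpr h⟩

theorem tau_type {k : Fin s} {T V : Type u} [AddCommGroup T] [Module R T] [AddCommGroup V] [Module R V]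
    (hV : HasType (D.e k) V) (h : IsTauOf R T V) : HasType (D.e (D.τ k)) T := by
  obtain ⟨hVs, hTs, L, ⟨c, hc0, hc2, hc⟩, ⟨-, p, hps, hpk⟩, ι, hι, hιr⟩ := h
  have hat : IsAtom (c 1) := by
    rw [← bot_covBy_iff]; have := hc 0; rwa [Fin.castSucc_zero, hc0] at this
  have hco : IsCoatom (c 1) := by
    rw [← covBy_top_iff]; have := hc 1
    rw [← hc2]; exact this
  have hra : IsAtom (LinearMap.range ι) := by
    rw [← isSimpleModule_iff_isAtom]
    exact (LinearEquiv.isSimpleModule_iff (LinearEquiv.ofInjective ι hι)).1 hTs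
  have h1 : c 1 = LinearMap.range ι := by
    have : c 1 ≤ LinearMap.range ι := by rw [hιr]; exact le_sSup hat
    exact (hra.le_iff.1 this).resolve_left hat.1
  have h2 : LinearMap.ker p = c 1 := by
    have hle : LinearMap.ker p ≤ c 1 := by rw [hpk]; exact sInf_le hco
    rcases hat.le_iff.1 hle with h3 | h3
    · exfalso
      have hcp : IsCoatom (LinearMap.ker p) :=
        isSimpleModule_iff_isCoatom.1 ((LinearEquiv.isSimpleModule_iff (p.quotKerEquivOfSurjective hps)).2 hVs)
      rw [h3] at hcp
      exact hco.1 (hcp.2 _ hat.bot_lt)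
    · exact h3
  obtain ⟨-, v, hv, hev⟩ := hV
  obtain ⟨m0, hm0⟩ := hps v
  set m : L := D.e k • m0 with hmdef
  have hpm : p m = v := by rw [map_smul, hm0, hev]
  have hem : D.e k • m = m := by rw [hmdef, ← mul_smul, D.idem]
  have hmc : m ∉ c 1 := by
    rw [← h2, LinearMap.mem_ker, hpm]; exact hv
  have hle : c 1 ≤ Submodule.span R {m} := by
    by_contra hnot
    have hinf : c 1 ⊓ Submodule.span R {m} = ⊥ :=
      (hat.le_iff.1 inf_le_left).resolve_right (fun h => hnot (inf_eq_left.1 h))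
    have hsup : c 1 ⊔ Submodule.span R {m} = ⊤ :=
      hco.2 _ (lt_of_le_of_ne le_sup_left (fun h => hmc (by
        rw [h]; exact Submodule.mem_sup_right (Submodule.mem_span_singleton_self m))))
    have hcompl : IsCompl (Submodule.span R {m}) (c 1) := (IsCompl.of_eq hinf hsup).symm
    have hma : IsAtom (Submodule.span R {m}) := hcompl.isAtom_iff_isCoatom.2 hco
    apply hmc
    rw [h1, hιr]
    exact (le_sSup hma : _ ≤ modSocle R L) (Submodule.mem_span_singleton_self m)
  obtain ⟨j, hj⟩ := D.types T hTs
  have hj' := hj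
  obtain ⟨-, t, ht, het⟩ := hj
  have hzc : ι t ∈ c 1 := by rw [h1]; exact ⟨t, rfl⟩
  obtain ⟨r, hr⟩ := Submodule.mem_span_singleton.1 (hle hzc)
  have hy : (D.e j * r * D.e k) • m = ι t := by
    rw [mul_smul, mul_smul, hem, hr, ← map_smul, het]
  have hye : D.e j * r * D.e k * D.e k = D.e j * r * D.e k := by rw [mul_assoc, D.idem]
  rcases (D.uni k).mem_or hye with hJ | ⟨w, hw⟩
  · obtain ⟨x, hx⟩ := D.α_gen k _ hJ hye
    by_cases hjk : j = D.τ k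
    · rw [← hjk]; exact hj'
    · exfalso
      have hJ2 : D.e j * x * D.e (D.τ k) ∈ J := D.sep (D.τ k) j _ (Ne.symm hjk) (by simp only [← mul_assoc, D.idem]) (by simp only [mul_assoc, D.idem])
      have hα : D.α k • m ∈ LinearMap.range ι := by
        rw [← h1, ← h2, LinearMap.mem_ker, map_smul, jac_kill (D.α_mem k)]
      obtain ⟨t', ht'⟩ := hα
      apply ht
      apply hι
      rw [map_zero, ← het, map_smul, ← hy, hx]
      calc D.e j • (x * D.α k) • m = (D.e j * x * D.e (D.τ k)) • D.α k • m := by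
            rw [mul_smul x, mul_smul (D.e j * x), mul_smul (D.e j), ← mul_smul (D.e (D.τ k)), e_α]
        _ = 0 := by rw [← ht', ← map_smul, jac_kill hJ2, map_zero]
  · exfalso
    apply hmc
    rw [← hem, ← hw, mul_smul, hy]
    exact (c 1).smul_mem _ hzc

theorem tau_mk {k : Fin s} {T V : Type u} [AddCommGroup T] [Module R T] [AddCommGroup V] [Module R V]
    (hV : HasType (D.e k) V) (hT : HasType (D.e (D.τ k)) T) : IsTauOf R T V := by
  have hg := D.genQ k 2 two_pos (D.two_le_c k)
  refine ⟨hV.1, hT.1, ModuleCat.of R (D.Q k 2), ?_, ?_, hg.isSocleOf hT⟩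
  · set m : D.Q k 2 := Submodule.mkQ _ (D.g k) with hm
    have hlt : Submodule.span R {D.a k (2-1) • m} < ⊤ := by
      rw [lt_top_iff_ne_top]
      intro h
      have : m ∈ Submodule.span R {D.a k (2-1) • m} := by rw [h]; trivial
      obtain ⟨r, hr⟩ := Submodule.mem_span_singleton.1 this
      rw [← mul_smul, show 2 - 1 = 1 from rfl, a_one] at hr
      obtain ⟨g', hg', -⟩ := jac_inv (jac_mul_left r (D.α_mem k))
      have hm0 : m = 0 := by
        calc m = (g' * (1 - r * D.α k)) • m := by rw [hg', one_smul]
          _ = 0 := by rw [mul_smul, sub_smul, hr, one_smul, sub_self, smul_zero]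
      exact hg.ne 1 (by omega) (by rw [hm0, smul_zero])
    refine ⟨![⊥, Submodule.span R {D.a k (2-1) • m}, ⊤], rfl, rfl, ?_⟩
    intro i
    fin_cases i
    · exact bot_covBy_iff.2 hg.atom
    · refine covBy_top_iff.2 ⟨hlt.ne, ?_⟩
      intro N hN
      obtain ⟨z, hzN, hz⟩ := SetLike.exists_of_lt hN
      have hz0 : z ≠ 0 := by rintro rfl; exact hz (zero_mem _)
      obtain ⟨l, hl, ⟨u, hu⟩, ⟨v, hv⟩⟩ := hg.elt z hz0
      have hl0 : l = 0 := by
        by_contra hl0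
        have : l = 1 := by omega
        subst this
        exact hz (Submodule.mem_span_singleton.2 ⟨u, hu.symm⟩)
      subst hl0
      rw [a_zero, hg.em] at hv
      rw [eq_top_iff]
      intro y _
      obtain ⟨r, rfl⟩ := hg.gen y
      rw [hv]; exact N.smul_mem _ (N.smul_mem _ hzN)
  · obtain ⟨q, h1, -, h2⟩ := D.exists_lift hg hV
    exact ⟨hV.1, q, h1, h2⟩

theorem γ_eq (i) : D.γ i = D.τ (D.τ^[D.c i - 1] i) := by
  have := D.two_le_c i
  rw [← Function.iterate_succ_apply' D.τ, γ]; congr 2; omega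

theorem gamma_iff {i : Fin s} {S T : Type u} [AddCommGroup S] [Module R S] [AddCommGroup T] [Module R T]
    (hS : HasType (D.e i) S) : GammaRel R S T ↔ HasType (D.e (D.γ i)) T := by
  rw [γ_eq]
  constructor
  · rintro ⟨-, M, p, hp, V, hV, hVM, hT⟩
    obtain ⟨φ, -⟩ := D.cover_equiv hS p hp
    exact D.tau_type (((D.genP i).congr φ).of_type hV hVM) hT
  · intro hT
    obtain ⟨q, hq⟩ := D.exists_cover hS
    exact ⟨hS.1, ModuleCat.of R (D.P i), q, hq, D.St (D.τ^[D.c i - 1] i), (D.St_type _).1,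
      (D.genP i).isSocleOf (D.St_type _), D.tau_mk (D.St_type _) hT⟩

end Bas
end Translate

section Final
variable {R : Type u} [Ring R] [IsArtinianRing R]

namespace Bas
variable {s : ℕ} (D : Bas R s)

/-- all vertices are black after `k` steps -/
def Blk (k : ℕ) : Prop := ∀ i, D.blk (D.γ^[k] i)
/-- periodic index -/
def Per (i : Fin s) : Prop := ∃ n, 0 < n ∧ D.γ^[n] i = i

theorem perm_F (b x) : (D.perm ^ (D.F b x)) b = D.γ ((D.perm ^ x) b) := by
  unfold F; rw [perm_add]; rfl

theorem perm_Fk (b x) (k : ℕ) : (D.perm ^ ((D.F b)^[k] x)) b = D.γ^[k] ((D.perm ^ x) b) := by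
  induction k with
  | zero => rfl
  | succ k ih => rw [Function.iterate_succ_apply', Function.iterate_succ_apply', perm_F, ih]

theorem blkZ_iff (k : ℕ) : (∀ b, BlkZ (D.F b) k) ↔ D.Blk k := by
  have key : ∀ b x, D.F b x < D.F b (x+1) ↔ D.blk ((D.perm ^ x) b) := by
    intro b x
    unfold F blk
    rw [perm_succ]
    omega
  constructor
  · intro h i
    have := h i 0
    rw [key, perm_Fk] at this
    simpa using this
  · intro h b x
    rw [key, perm_Fk]
    exact h _

theorem Per.iter {D : Bas R s} {i} (h : D.Per i) (m : ℕ) : D.Per (D.γ^[m] i) := by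
  obtain ⟨n, hn, h⟩ := h
  exact ⟨n, hn, by rw [← Function.iterate_add_apply, add_comm, Function.iterate_add_apply, h]⟩

theorem exists_per (i) : ∃ k, D.Per (D.γ^[k] i) := by
  obtain ⟨x, y, hne, h⟩ := Finite.exists_ne_map_eq_of_infinite (fun k : ℕ => D.γ^[k] i)
  have key : ∀ x y : ℕ, x < y → D.γ^[x] i = D.γ^[y] i → ∃ k, D.Per (D.γ^[k] i) := by
    intro x y hxy h
    refine ⟨x, y - x, by omega, ?_⟩
    rw [← Function.iterate_add_apply, Nat.sub_add_cancel hxy.le, h]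
  rcases lt_or_gt_of_ne hne with h1 | h1
  · exact key x y h1 h
  · exact key y x h1 h.symm

theorem exists_per_all : ∃ k, ∀ i, D.Per (D.γ^[k] i) := by
  choose k hk using D.exists_per
  refine ⟨∑ i, k i, fun i => ?_⟩
  have hle : k i ≤ ∑ i, k i := Finset.single_le_sum (fun _ _ => Nat.zero_le _) (Finset.mem_univ i)
  have := (hk i).iter (∑ i, k i - k i)
  rwa [← Function.iterate_add_apply, Nat.sub_add_cancel hle] at this

theorem per_iff : (∀ i, D.Per i → D.blk i) ↔ ∃ k, D.Blk k := by
  constructor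
  · intro h
    obtain ⟨k, hk⟩ := D.exists_per_all
    exact ⟨k, fun i => h _ (hk i)⟩
  · rintro ⟨k, hk⟩ i ⟨n, hn, hi⟩
    have h1 : D.γ^[n * k] i = i := by
      rw [Function.iterate_mul]
      exact Function.iterate_fixed hi k
    have h2 : k ≤ n * k := Nat.le_mul_of_pos_left k hn
    have := hk (D.γ^[n * k - k] i)
    rwa [← Function.iterate_add_apply, Nat.add_sub_cancel' h2, h1] at this

theorem path_type (C : ℕ → ModuleCat.{u} R) (n : ℕ) (hC : ∀ i < n, GammaRel R (C i) (C (i+1)))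
    {i : Fin s} (h0 : HasType (D.e i) (C 0)) : ∀ m ≤ n, HasType (D.e (D.γ^[m] i)) (C m) := by
  intro m
  induction m with
  | zero => intro _; exact h0
  | succ m ih =>
    intro hm
    rw [Function.iterate_succ_apply']
    exact (D.gamma_iff (ih (by omega))).1 (hC m (by omega))

theorem st_path (i : Fin s) (m : ℕ) : GammaRel R (D.St (D.γ^[m] i)) (D.St (D.γ^[m+1] i)) := by
  rw [D.gamma_iff (D.St_type _), ← Function.iterate_succ_apply' D.γ]
  exact D.St_type _

theorem acb_iff : AllCyclesBlack R ↔ ∀ i, D.Per i → D.blk i := by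
  constructor
  · rintro h i ⟨n, hn, hi⟩
    have := h n (fun m => D.St (D.γ^[m] i)) hn (fun m _ => D.st_path i m)
      ⟨LinearEquiv.cast (R := R) (M := fun j => (D.St j : Type u)) hi⟩ 0 (Nat.zero_le _)
    exact (D.black_iff (D.St_type i)).1 this
  · rintro h n C hn hC ⟨φ⟩ m hm
    obtain ⟨i, hi⟩ := D.types (C 0) (hC 0 hn).1
    have hp := D.path_type C n hC hi
    have hni : D.γ^[n] i = i := D.type_unique ((hp n le_rfl).congr φ) hi
    exact (D.black_iff (hp m hm)).2 (h _ (Per.iter ⟨n, hn, hni⟩ m))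

theorem cyc_per {S : Type u} [AddCommGroup S] [Module R S] {i : Fin s} (hS : HasType (D.e i) S)
    (h : IsCyclicallyBlack R S) : D.Per i := by
  obtain ⟨n, C, hn, ⟨φ0⟩, ⟨φn⟩, hC, -⟩ := h
  have hp := D.path_type C n hC (hS.congr φ0.symm)
  exact ⟨n, hn, D.type_unique ((hp n le_rfl).congr φn) hS⟩

theorem reach_per {S : Type u} [AddCommGroup S] [Module R S] {i : Fin s} (hS : HasType (D.e i) S) {m : ℕ}
    (h : ReachesBlackIn R S m) : D.Per (D.γ^[m] i) := by
  obtain ⟨C, ⟨φ⟩, hC, hcyc⟩ := h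
  exact D.cyc_per (D.path_type C m hC (hS.congr φ.symm) m le_rfl) hcyc

theorem per_reach (hb : ∀ i, D.Per i → D.blk i) {S : Type u} [AddCommGroup S] [Module R S] {i : Fin s}
    (hS : HasType (D.e i) S) {m : ℕ} (h : D.Per (D.γ^[m] i)) : ReachesBlackIn R S m := by
  refine ⟨fun m => D.St (D.γ^[m] i), (D.St_type i).equiv (D.uni i) hS, fun m _ => D.st_path i m, ?_⟩
  have h' := h
  obtain ⟨n, hn, hi⟩ := h
  refine ⟨n, fun l => D.St (D.γ^[l] (D.γ^[m] i)), hn, ⟨LinearEquiv.refl _ _⟩,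
    ⟨LinearEquiv.cast (R := R) (M := fun j => (D.St j : Type u)) hi⟩, fun l _ => D.st_path _ l, ?_⟩
  intro l _
  exact (D.black_iff (D.St_type _)).2 (hb _ (h'.iter l))

theorem blk_per (hp : MinProjLengthGT R s) {k : ℕ} (hk : D.Blk k) (i) : D.Per (D.γ^[k] i) := by
  have h1 : ∀ i, ∃ j, D.γ^[k] i = D.γ^[k+1] j := by
    intro i
    obtain ⟨y, hy⟩ := BlkZ.surj (D.F_mono i) ((D.Z hp).Npos i) ((D.Z hp).shift i) ((D.blkZ_iff k).2 hk i) 0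
    refine ⟨(D.perm ^ y) i, ?_⟩
    rw [← perm_Fk, ← hy, perm_Fk]; simp
  have h2 : ∀ n i, ∃ j, D.γ^[k] i = D.γ^[n + k] j := by
    intro n
    induction n with
    | zero => intro i; exact ⟨i, by rw [zero_add]⟩
    | succ n ih =>
      intro i
      obtain ⟨j, hj⟩ := ih i
      obtain ⟨j', hj'⟩ := h1 j
      exact ⟨j', by rw [hj, show n + 1 + k = n + (k + 1) by omega, Function.iterate_add_apply D.γ n k, hj', ← Function.iterate_add_apply D.γ n (k+1)]⟩
  obtain ⟨K, hK⟩ := D.exists_per_all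
  obtain ⟨j, hj⟩ := h2 K i
  rw [hj, Function.iterate_add_apply]
  exact hK _

end Bas

theorem main_aux (Λ : Type u) [Ring Λ] [hN : IsNakayama Λ] (h0 : NoSimpleProjectives Λ)
    (s : ℕ) (hs : SimpleCount Λ s) (hp : MinProjLengthGT Λ s) :
    (IsGorensteinAlg Λ ↔ AllCyclesBlack Λ) ∧
    (AllCyclesBlack Λ → ∀ d : ℕ, MaxDistToBlack Λ d →
      InjDimLE Λ Λ (2 * d) ∧ InjDimLE Λᵐᵒᵖ Λ (2 * d) ∧
      (∀ m < 2 * d, ¬ InjDimLE Λ Λ m) ∧ ∀ m < 2 * d, ¬ InjDimLE Λᵐᵒᵖ Λ m) := by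
  have : IsArtinianRing Λ := hN.artinian
  obtain ⟨D⟩ := exists_bas h0 s hs
  have hl : ∀ n, InjDimLE Λ Λ n ↔ D.Blk (n/2) := fun n =>
    ((D.Z hp).injDimLE_iff n).trans (D.blkZ_iff _)
  have hr : ∀ n, InjDimLE Λᵐᵒᵖ Λ n ↔ D.Blk (n/2) := fun n =>
    ((D.Z hp).op_injDimLE_iff n).trans (D.blkZ_iff _)
  constructor
  · rw [D.acb_iff, D.per_iff]
    constructor
    · rintro ⟨⟨n, hn⟩, -⟩
      exact ⟨_, (hl n).1 hn⟩
    · rintro ⟨k, hk⟩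
      have : 2 * k / 2 = k := by omega
      exact ⟨⟨2 * k, (hl _).2 (by rwa [this])⟩, ⟨2 * k, (hr _).2 (by rwa [this])⟩⟩
  · intro hacb d ⟨hd1, S, hS, hd2⟩
    rw [D.acb_iff] at hacb
    have h2 : 2 * d / 2 = d := by omega
    have hB : D.Blk d := by
      intro i
      obtain ⟨m, hm, hre⟩ := hd1 (D.St i) (D.St_type i).1
      have := (D.reach_per (D.St_type i) hre).iter (d - m)
      rw [← Function.iterate_add_apply, Nat.sub_add_cancel hm] at this
      exact hacb _ this
    have hlow : ∀ k < d, ¬ D.Blk k := by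
      intro k hk hb
      obtain ⟨i, hi⟩ := D.types S hS
      exact hd2 k hk (D.per_reach hacb hi (D.blk_per hp hb i))
    refine ⟨(hl _).2 (by rwa [h2]), (hr _).2 (by rwa [h2]), ?_, ?_⟩
    · intro m hm h
      exact hlow (m/2) (by omega) ((hl m).1 h)
    · intro m hm h
      exact hlow (m/2) (by omega) ((hr m).1 h)

end Final

/-- Gorenstein criterion for a Nakayama algebra without simple projectives with `p > s`:
`Λ` is a Gorenstein algebra iff every cycle in the resolution quiver consists of black
vertices; in that case the Gorenstein dimension (the common injective dimension of `Λ` as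
a left and right module over itself) equals `2d`, where `d` is the maximal distance of a
vertex of the resolution quiver to the black cycles. -/
theorem gorenstein_iff_all_cycles_black [IsNakayama Λ] (h0 : NoSimpleProjectives Λ)
    (s : ℕ) (hs : SimpleCount Λ s) (hp : MinProjLengthGT Λ s) :
    (IsGorensteinAlg Λ ↔ AllCyclesBlack Λ) ∧
    (AllCyclesBlack Λ → ∀ d : ℕ, MaxDistToBlack Λ d →
      InjDimLE Λ Λ (2 * d) ∧ InjDimLE Λᵐᵒᵖ Λ (2 * d) ∧
      (∀ m < 2 * d, ¬ InjDimLE Λ Λ m) ∧ ∀ m < 2 * d, ¬ InjDimLE Λᵐᵒᵖ Λ m) := by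
  exact main_aux Λ h0 s hs hp
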